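/- arXiv:2406.13580 — 4 statements merged into one kernel-verified Lean document; each statement's English description precedes it below -/
import Mathlib

section
/- Let S₃ = ⟨d₁,d₂,d₃⟩ be a numerical semigroup minimally generated by three positive integers, with genus G₀. Then the rescaled quantity h₀ = K₀/g₃, where K₀ = G₀ + (d₁+d₂+d₃−1)/2, satisfies 1/2 ≤ h₀ < 5/9; equivalently, F₃ + σ₁ ≤ 2G₀ + σ₁ − 1 and 9·(2G₀ + σ₁ − 1) < 10·(F₃ + σ₁). -/
/-- A numerical semigroup: a subset of ℕ containing 0, closed under addition,
with finite complement (the set of gaps). -/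
def IsNumericalSemigroup (S : Set ℕ) : Prop :=
  0 ∈ S ∧ (∀ a ∈ S, ∀ b ∈ S, a + b ∈ S) ∧ (Sᶜ : Set ℕ).Finite

/-- The genus: the number of gaps of `S`. -/
noncomputable def genus (S : Set ℕ) : ℕ := (Sᶜ : Set ℕ).ncard

/-- The Frobenius number: the largest gap of `S`. -/
noncomputable def frobeniusNum (S : Set ℕ) : ℕ := sSup (Sᶜ : Set ℕ)

/-- The conductorNum: the least `c` such that every `n ≥ c` belongs to `S`
(equal to `frobeniusNum S + 1` when `S ≠ ℕ`). -/
noncomputable def conductorNum (S : Set ℕ) : ℕ := sInf {c : ℕ | ∀ n : ℕ, c ≤ n → n ∈ S}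

/-- `S` is symmetric: for every `n` with `0 ≤ n ≤ F` (where `F = conductorNum S - 1` is the
Frobenius number), `n` is a gap iff `F - n ∈ S`. -/
def IsSymmetric (S : Set ℕ) : Prop :=
  ∀ n : ℕ, n < conductorNum S → (n ∉ S ↔ conductorNum S - 1 - n ∈ S)

/-- The submonoid of ℕ generated by two elements. -/
def gen2 (x y : ℕ) : Set ℕ := {n : ℕ | ∃ a b : ℕ, n = a * x + b * y}

/-- The numerical semigroup `⟨d₁, d₂, d₃⟩` generated by three elements. -/
def gen3 (d₁ d₂ d₃ : ℕ) : Set ℕ := {n : ℕ | ∃ a b c : ℕ, n = a * d₁ + b * d₂ + c * d₃}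

/-- `⟨d₁, d₂, d₃⟩` is minimally generated by the three positive integers `d₁ < d₂ < d₃`:
`gcd(d₁,d₂,d₃) = 1`, `3 ≤ d₁`, `d₃ ≤ d₁d₂ - d₁ - d₂`, and no generator lies in the
submonoid generated by the other two. -/
def MinGen3 (d₁ d₂ d₃ : ℕ) : Prop :=
  3 ≤ d₁ ∧ d₁ < d₂ ∧ d₂ < d₃ ∧ d₃ + d₁ + d₂ ≤ d₁ * d₂ ∧
    Nat.gcd d₁ (Nat.gcd d₂ d₃) = 1 ∧
    d₁ ∉ gen2 d₂ d₃ ∧ d₂ ∉ gen2 d₁ d₃ ∧ d₃ ∉ gen2 d₁ d₂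

/-- The `r`-th gap power sum (higher genus) `G_r = Σ_{s gap} s^r`. -/
noncomputable def gapPowerSum (S : Set ℕ) (r : ℕ) : ℕ := ∑ᶠ s ∈ (Sᶜ : Set ℕ), s ^ r

/-- One run of the Euclidean-type reduction of a basis `(s, P), (s', P')` of the lattice of pairs
`(j, k)` with `j d₂ ≡ k d₃ [ZMOD d₁]`. It stops when `R' = (s' d₂ - P' d₃) / d₁` is nonpositive. -/
lemma exists_minors_of_basis {d₁ d₂ d₃ : ℤ} (hd₁ : 0 < d₁) (hd₃ : 0 < d₃) (N : ℕ) :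
    ∀ s s' P P' R R' : ℤ, s' ≤ N → 0 ≤ s' → s' < s → 0 ≤ P → P < P' → 0 < R →
      s * P' - s' * P = d₁ → s * d₂ = R * d₁ + P * d₃ → s' * d₂ = R' * d₁ + P' * d₃ →
      ∃ a b c x y z : ℤ, 0 < a ∧ 0 ≤ b ∧ 0 < c ∧ 0 ≤ x ∧ 0 < y ∧ 0 ≤ z ∧
        d₁ = b * c + y * c + y * z ∧ d₂ = a * c + a * z + x * z ∧
        d₃ = a * b + x * b + x * y := by
  induction N with
  | zero =>
    intro s s' P P' R R' hN hs' hs hP hP' hR hdet h1 h2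
    have hs0 : s' = 0 := by simp at hN; omega
    subst hs0
    have hR' : R' ≤ 0 := by nlinarith
    refine ⟨R, 0, P' - P, -R', s - 0, P, hR, le_rfl, by omega, by omega, by omega, hP, ?_, ?_, ?_⟩
    · linarith
    · apply mul_left_cancel₀ hd₁.ne'
      subst hdet
      linear_combination P' * h1 - P * h2
    · apply mul_left_cancel₀ hd₁.ne'
      subst hdet
      linear_combination -s * h2
  | succ N ih =>
    intro s s' P P' R R' hN hs' hs hP hP' hR hdet h1 h2
    by_cases hR' : R' ≤ 0
    · refine ⟨R, s', P' - P, -R', s - s', P, hR, hs', by omega, by omega, by omega, hP, ?_, ?_, ?_⟩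
      · linarith
      · apply mul_left_cancel₀ hd₁.ne'
        linear_combination P' * h1 - P * h2 - d₂ * hdet
      · apply mul_left_cancel₀ hd₁.ne'
        linear_combination s' * h1 - s * h2 - d₃ * hdet
    · push Not at hR'
      have hs'0 : 0 < s' := by
        rcases hs'.lt_or_eq with h | h
        · exact h
        · subst h
          nlinarith
      have hm := Int.emod_nonneg (-s) hs'0.ne'
      have hm' := Int.emod_lt_of_pos (-s) hs'0
      have hq := Int.emod_add_mul_ediv (-s) s'
      set q := -((-s) / s') with hqdef
      have hq' : (-s) / s' = -q := by omega
      rw [hq'] at hq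
      have hq2 : 2 ≤ q := by
        by_contra hlt
        have : q ≤ 1 := by omega
        nlinarith
      refine ih s' (q * s' - s) P' (q * P' - P) R' (q * R' - R) ?_ ?_ ?_ ?_ ?_ hR' ?_ h2 ?_
      · push_cast at hN
        linarith
      · linarith
      · linarith
      · linarith
      · nlinarith
      · linear_combination hdet
      · linear_combination q * h2 - h1

/-- Herzog's structure theorem: coprime `d₁, d₂, d₃` are the degrees read off the exponents of a
`2 × 3` matrix of monomials whose maximal minors define the semigroup. -/
lemma exists_minors {d₁ d₂ d₃ : ℕ} (h₁ : 0 < d₁) (h₂ : 0 < d₂) (h₃ : 0 < d₃) :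
    ∃ a b c x y z : ℕ, 0 < a ∧ 0 < c ∧ 0 < y ∧
      d₁ = b * c + y * c + y * z ∧ d₂ = a * c + a * z + x * z ∧
      d₃ = a * b + x * b + x * y := by
  obtain ⟨g, e₁, e₂, hg, hco, he₁, he₂⟩ :=
    Nat.exists_coprime' (m := d₁) (n := d₂) (Nat.gcd_pos_of_pos_left _ h₁)
  have he₁0 : 0 < e₁ := by
    rcases Nat.eq_zero_or_pos e₁ with h | h
    · simp [h] at he₁; omega
    · exact h
  have he₂0 : 0 < e₂ := by
    rcases Nat.eq_zero_or_pos e₂ with h | h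
    · simp [h] at he₂; omega
    · exact h
  have hbez : (1 : ℤ) = e₁ * Nat.gcdA e₁ e₂ + e₂ * Nat.gcdB e₁ e₂ := by
    rw [← Nat.gcd_eq_gcd_ab, hco.gcd_eq_one, Nat.cast_one]
  set u := Nat.gcdA e₁ e₂
  set v := Nat.gcdB e₁ e₂
  have he₁' : (0 : ℤ) < e₁ := by exact_mod_cast he₁0
  have hdiv := Int.emod_add_mul_ediv (v * d₃) e₁
  set s' := (v * d₃) % (e₁ : ℤ)
  set t := (v * d₃) / (e₁ : ℤ)
  have hs'0 : 0 ≤ s' := Int.emod_nonneg _ he₁'.ne'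
  have hs'1 : s' < e₁ := Int.emod_lt_of_pos _ he₁'
  obtain ⟨a, b, c, x, y, z, ha, hb, hc, hx, hy, hz, e1, e2, e3⟩ :=
    exists_minors_of_basis (d₁ := d₁) (d₂ := d₂) (d₃ := d₃) (by exact_mod_cast h₁)
      (by exact_mod_cast h₃) s'.toNat e₁ s' 0 g e₂ (-(u * d₃ + e₂ * t))
      (by omega) hs'0 hs'1 le_rfl (by exact_mod_cast hg) (by exact_mod_cast he₂0)
      (by rw [he₁]; push_cast; ring) (by rw [he₁, he₂]; push_cast; ring)
      (by
        rw [he₂]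
        nth_rewrite 1 [he₁]
        push_cast
        linear_combination (e₂ * g : ℤ) * hdiv - (g * d₃ : ℤ) * hbez)
  lift a to ℕ using ha.le
  lift b to ℕ using hb
  lift c to ℕ using hc.le
  lift x to ℕ using hx
  lift y to ℕ using hy.le
  lift z to ℕ using hz
  exact ⟨a, b, c, x, y, z, by exact_mod_cast ha, by exact_mod_cast hc, by exact_mod_cast hy,
    by exact_mod_cast e1, by exact_mod_cast e2, by exact_mod_cast e3⟩

/-- The L-shaped region indexing the Apéry set of `⟨d₁, d₂, d₃⟩` with respect to `d₁`. -/
def lShape (b c y z : ℕ) : Finset (ℕ × ℕ) :=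
  Finset.range y ×ˢ Finset.range (c + z) ∪ Finset.Ico y (y + b) ×ˢ Finset.range c

lemma mem_lShape {b c y z : ℕ} {p : ℕ × ℕ} :
    p ∈ lShape b c y z ↔ p.1 < y + b ∧ p.2 < c + z ∧ (p.1 < y ∨ p.2 < c) := by
  simp only [lShape, Finset.mem_union, Finset.mem_product, Finset.mem_range, Finset.mem_Ico]
  omega

lemma sum_lShape (b c y z : ℕ) (f : ℕ × ℕ → ℕ) :
    ∑ p ∈ lShape b c y z, f p = ∑ j ∈ Finset.range y, ∑ k ∈ Finset.range (c + z), f (j, k) +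
      ∑ j ∈ Finset.range b, ∑ k ∈ Finset.range c, f (y + j, k) := by
  rw [lShape, Finset.sum_union, Finset.sum_product, Finset.sum_product, Finset.sum_Ico_eq_sum_range]
  · simp
  · rw [Finset.disjoint_left]
    simp only [Finset.mem_product, Finset.mem_range, Finset.mem_Ico]
    omega

lemma card_lShape (b c y z : ℕ) : (lShape b c y z).card = b * c + y * c + y * z := by
  rw [Finset.card_eq_sum_ones, sum_lShape]
  simp
  ring

lemma two_mul_sum_rectangle (B C e f t : ℤ) (m n : ℕ) (hB : B = m) (hC : C = n) :
    2 * ∑ j ∈ Finset.range m, ∑ k ∈ Finset.range n, ((t + j) * e + k * f) =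
      B * C * ((2 * t + B - 1) * e + (C - 1) * f) := by
  subst hB hC
  have hsum : ∀ N : ℕ, 2 * ∑ i ∈ Finset.range N, (i : ℤ) = N * (N - 1) := by
    intro N
    induction N with
    | zero => simp
    | succ N ih => rw [Finset.sum_range_succ, mul_add, ih]; push_cast; ring
  simp only [Finset.sum_add_distrib, Finset.sum_const, Finset.card_range, nsmul_eq_mul,
    ← Finset.sum_mul, ← Finset.mul_sum]
  linear_combination (n * e : ℤ) * hsum m + (m * f : ℤ) * hsum n

section Minors

variable {d₁ d₂ d₃ a b c x y z : ℕ}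

lemma two_mul_sum_weight (e1 : d₁ = b * c + y * c + y * z) (e2 : d₂ = a * c + a * z + x * z)
    (e3 : d₃ = a * b + x * b + x * y) :
    2 * ∑ p ∈ lShape b c y z, (p.1 * d₂ + p.2 * d₃) + d₁ * (d₂ + d₃) =
      d₁ * ((a + x) * (b + y) * (c + z) + a * b * c + x * y * z) := by
  rw [sum_lShape]
  have h1 := two_mul_sum_rectangle y (c + z) d₂ d₃ 0 y (c + z) rfl (by push_cast; rfl)
  have h2 := two_mul_sum_rectangle b c d₂ d₃ y b c rfl rfl
  zify
  simp only [zero_add] at h1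
  rw [mul_add, h1, h2]
  subst e1 e2 e3
  push_cast
  ring

/-- Rewriting by the three relations moves every pair into the L-shape. -/
lemma exists_lShape_reduction (ha : 0 < a) (hc : 0 < c) (hy : 0 < y)
    (e1 : d₁ = b * c + y * c + y * z) (e2 : d₂ = a * c + a * z + x * z)
    (e3 : d₃ = a * b + x * b + x * y) (h₁ : 0 < d₁) (j k : ℕ) :
    ∃ t : ℕ, ∃ p ∈ lShape b c y z, j * d₂ + k * d₃ = t * d₁ + (p.1 * d₂ + p.2 * d₃) := by
  have r1 : (y + b) * d₂ = a * d₁ + z * d₃ := by subst e1 e2 e3; ring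
  have r2 : y * d₂ + c * d₃ = (a + x) * d₁ := by subst e1 e2 e3; ring
  have r3 : (c + z) * d₃ = x * d₁ + b * d₂ := by subst e1 e2 e3; ring
  by_cases hj : y + b ≤ j
  · obtain ⟨i, rfl⟩ := Nat.exists_eq_add_of_le hj
    have hdec : (y + b + i) * d₂ + k * d₃ = a * d₁ + (i * d₂ + (k + z) * d₃) := by
      linear_combination r1
    have : 0 < a * d₁ := Nat.mul_pos ha h₁
    obtain ⟨t, p, hp, h⟩ := exists_lShape_reduction ha hc hy e1 e2 e3 h₁ i (k + z)
    exact ⟨a + t, p, hp, by rw [hdec, h]; ring⟩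
  by_cases hk : c + z ≤ k
  · obtain ⟨i, rfl⟩ := Nat.exists_eq_add_of_le hk
    have hdec : j * d₂ + (c + z + i) * d₃ = x * d₁ + ((j + b) * d₂ + i * d₃) := by
      linear_combination r3
    obtain ⟨t, p, hp, h⟩ := exists_lShape_reduction ha hc hy e1 e2 e3 h₁ (j + b) i
    exact ⟨x + t, p, hp, by rw [hdec, h]; ring⟩
  by_cases hjk : y ≤ j ∧ c ≤ k
  · obtain ⟨i, rfl⟩ := Nat.exists_eq_add_of_le hjk.1
    obtain ⟨l, rfl⟩ := Nat.exists_eq_add_of_le hjk.2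
    have hdec : (y + i) * d₂ + (c + l) * d₃ = (a + x) * d₁ + (i * d₂ + l * d₃) := by
      linear_combination r2
    have : 0 < (a + x) * d₁ := Nat.mul_pos (by omega) h₁
    obtain ⟨t, p, hp, h⟩ := exists_lShape_reduction ha hc hy e1 e2 e3 h₁ i l
    exact ⟨a + x + t, p, hp, by rw [hdec, h]; ring⟩
  · exact ⟨0, (j, k), mem_lShape.2 ⟨by omega, by omega, by dsimp only; omega⟩, by simp⟩
termination_by (j * d₂ + k * d₃, k)
decreasing_by
  all_goals rw [Prod.lex_def]
  all_goals dsimp only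
  all_goals grind

end Minors

lemma exists_modEq_combination {d₁ d₂ d₃ : ℕ} (h₁ : 0 < d₁)
    (hgcd : Nat.gcd d₁ (Nat.gcd d₂ d₃) = 1) (r : ℕ) :
    ∃ j k : ℕ, j * d₂ + k * d₃ ≡ r [MOD d₁] := by
  have hg := Nat.gcd_eq_gcd_ab d₁ (Nat.gcd d₂ d₃)
  rw [hgcd, Nat.gcd_eq_gcd_ab d₂ d₃] at hg
  set q := Nat.gcdB d₁ (Nat.gcd d₂ d₃)
  set u := Nat.gcdA d₂ d₃
  set v := Nat.gcdB d₂ d₃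
  have h₁' : (d₁ : ℤ) ≠ 0 := by exact_mod_cast h₁.ne'
  refine ⟨((r * (u * q)) % (d₁ : ℤ)).toNat, ((r * (v * q)) % (d₁ : ℤ)).toNat, ?_⟩
  rw [← Int.natCast_modEq_iff]
  push_cast
  rw [Int.toNat_of_nonneg (Int.emod_nonneg _ h₁'), Int.toNat_of_nonneg (Int.emod_nonneg _ h₁')]
  calc _ ≡ r * (u * q) * d₂ + r * (v * q) * d₃ [ZMOD d₁] :=
        ((Int.mod_modEq _ _).mul_right _).add ((Int.mod_modEq _ _).mul_right _)
    _ ≡ r [ZMOD d₁] := by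
        rw [Int.modEq_iff_dvd]
        exact ⟨r * Nat.gcdA d₁ (Nat.gcd d₂ d₃), by push_cast at hg; linear_combination (r : ℤ) * hg⟩

/-- `A` indexes, through `w`, the Apéry set of `S` with respect to `d`: the values of `w` on `A`
represent each residue class modulo `d` once, by the least element of `S` in that class. -/
structure IsAperyIndexing {α : Type*} (S : Set ℕ) (d : ℕ) (A : Finset α) (w : α → ℕ) : Prop where
  pos : 0 < d
  injOn : Set.InjOn (fun p => w p % d) (A : Set α)
  exists_modEq : ∀ n : ℕ, ∃ p ∈ A, w p ≡ n [MOD d]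
  mem_iff : ∀ p ∈ A, ∀ n : ℕ, w p ≡ n [MOD d] → (n ∈ S ↔ w p ≤ n)

namespace IsAperyIndexing

variable {α : Type*} {S : Set ℕ} {d : ℕ} {A : Finset α} {w : α → ℕ}

lemma sum_mod (h : IsAperyIndexing S d A w) : ∑ p ∈ A, w p % d = ∑ r ∈ Finset.range d, r := by
  refine Finset.sum_bij (fun p _ => w p % d) (fun p _ => Finset.mem_range.2 (Nat.mod_lt _ h.pos))
    (fun p hp q hq hpq => h.injOn hp hq hpq) (fun r hr => ?_) (fun _ _ => rfl)
  obtain ⟨p, hp, hpr⟩ := h.exists_modEq r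
  exact ⟨p, hp, Eq.trans hpr (Nat.mod_eq_of_lt (Finset.mem_range.1 hr))⟩

lemma compl_eq_image (h : IsAperyIndexing S d A w) :
    Sᶜ = (fun i : (_ : α) × ℕ => w i.1 % d + i.2 * d) ''
      (A.sigma (fun p => Finset.range (w p / d)) : Finset ((_ : α) × ℕ)) := by
  ext n
  simp only [Set.mem_compl_iff, Set.mem_image, Finset.coe_sigma, Set.mem_sigma_iff,
    Finset.mem_coe, Finset.mem_range]
  constructor
  · intro hn
    obtain ⟨p, hp, hpn⟩ := h.exists_modEq n
    rw [h.mem_iff p hp n hpn, not_le] at hn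
    refine ⟨⟨p, n / d⟩, ⟨hp, ?_⟩, ?_⟩
    · have h1 := Nat.mod_add_div n d
      have h2 := Nat.mod_add_div (w p) d
      have h3 : w p % d = n % d := hpn
      rw [h3] at h2
      exact lt_of_mul_lt_mul_left (by omega : d * (n / d) < d * (w p / d)) (Nat.zero_le d)
    · have h3 : w p % d = n % d := hpn
      dsimp only
      rw [h3, mul_comm, Nat.mod_add_div]
  · rintro ⟨⟨p, i⟩, ⟨hp, hi⟩, rfl⟩
    have hmod : w p ≡ w p % d + i * d [MOD d] := by simp [Nat.ModEq]
    dsimp only at *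
    rw [h.mem_iff p hp _ hmod, not_le]
    have h2 := Nat.mod_add_div (w p) d
    have : d * i < d * (w p / d) := Nat.mul_lt_mul_of_pos_left hi h.pos
    rw [mul_comm i d]
    omega

lemma finite_compl (h : IsAperyIndexing S d A w) : (Sᶜ : Set ℕ).Finite := by
  rw [h.compl_eq_image]
  exact (Finset.finite_toSet _).image _

lemma genus_eq (h : IsAperyIndexing S d A w) : genus S = ∑ p ∈ A, w p / d := by
  have hinj : Set.InjOn (fun i : (_ : α) × ℕ => w i.1 % d + i.2 * d)
      (A.sigma (fun p => Finset.range (w p / d)) : Finset ((_ : α) × ℕ)) := by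
    rintro ⟨p, i⟩ hp ⟨q, j⟩ hq hpq
    simp only [Finset.coe_sigma, Set.mem_sigma_iff, Finset.mem_coe] at hp hq
    have hmod := congrArg (· % d) hpq
    simp only [Nat.add_mul_mod_self_right, Nat.mod_mod] at hmod
    obtain rfl := h.injOn hp.1 hq.1 hmod
    have hij : i = j := Nat.eq_of_mul_eq_mul_right h.pos (by dsimp only at hpq; omega)
    rw [hij]
  rw [genus, h.compl_eq_image, hinj.ncard_image, Set.ncard_coe_finset, Finset.card_sigma]
  simp

/-- Selmer's formula for the genus. -/
lemma two_mul_sum (h : IsAperyIndexing S d A w) :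
    2 * ∑ p ∈ A, w p + d = d * (2 * genus S + d) := by
  have hsplit : ∑ p ∈ A, w p = ∑ r ∈ Finset.range d, r + d * genus S := by
    rw [← h.sum_mod, h.genus_eq, Finset.mul_sum, ← Finset.sum_add_distrib]
    exact Finset.sum_congr rfl fun p _ => (Nat.mod_add_div _ _).symm
  have hg := Finset.sum_range_id_mul_two d
  obtain ⟨e, rfl⟩ := Nat.exists_eq_add_of_lt h.pos
  simp only [zero_add, Nat.add_sub_cancel] at *
  rw [hsplit]
  linear_combination hg

lemma le_frobeniusNum_add (h : IsAperyIndexing S d A w) {p : α} (hp : p ∈ A) :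
    w p ≤ frobeniusNum S + d := by
  rcases le_or_gt d (w p) with hd | hd
  · have hgap : w p - d ∉ S := by
      rw [h.mem_iff p hp _ ((Nat.modEq_iff_dvd' (Nat.sub_le _ _)).2
        ⟨1, by rw [Nat.sub_sub_self hd, mul_one]⟩).symm]
      have := h.pos
      omega
    have := le_csSup h.finite_compl.bddAbove hgap
    rw [frobeniusNum]
    omega
  · omega

lemma exists_frobeniusNum_add_le (h : IsAperyIndexing S d A w) (hS : (Sᶜ : Set ℕ).Nonempty) :
    ∃ p ∈ A, frobeniusNum S + d ≤ w p := by
  have hF : frobeniusNum S ∉ S := Nat.sSup_mem hS h.finite_compl.bddAbove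
  obtain ⟨p, hp, hmod⟩ := h.exists_modEq (frobeniusNum S)
  refine ⟨p, hp, ?_⟩
  rw [h.mem_iff p hp _ hmod, not_le] at hF
  exact hmod.symm.add_le_of_lt hF

end IsAperyIndexing

section Minors

variable {d₁ d₂ d₃ a b c x y z : ℕ}

lemma isAperyIndexing_lShape (ha : 0 < a) (hc : 0 < c) (hy : 0 < y)
    (e1 : d₁ = b * c + y * c + y * z) (e2 : d₂ = a * c + a * z + x * z)
    (e3 : d₃ = a * b + x * b + x * y) (h₁ : 0 < d₁)
    (hgcd : Nat.gcd d₁ (Nat.gcd d₂ d₃) = 1) :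
    IsAperyIndexing (gen3 d₁ d₂ d₃) d₁ (lShape b c y z) (fun p => p.1 * d₂ + p.2 * d₃) := by
  have hred := exists_lShape_reduction ha hc hy e1 e2 e3 h₁
  have hex : ∀ n : ℕ, ∃ p ∈ lShape b c y z, p.1 * d₂ + p.2 * d₃ ≡ n [MOD d₁] := by
    intro n
    obtain ⟨j, k, hjk⟩ := exists_modEq_combination h₁ hgcd n
    obtain ⟨t, p, hp, h⟩ := hred j k
    refine ⟨p, hp, Nat.ModEq.trans ?_ hjk⟩
    rw [h]
    simp [Nat.ModEq]
  have hinj : Set.InjOn (fun p : ℕ × ℕ => (p.1 * d₂ + p.2 * d₃) % d₁)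
      (lShape b c y z : Set (ℕ × ℕ)) := by
    refine Finset.injOn_of_surjOn_of_card_le (t := Finset.range d₁) _
      (fun p _ => by simpa using Nat.mod_lt _ h₁) (fun r hr => ?_) (by simp [card_lShape, e1])
    obtain ⟨p, hp, hpr⟩ := hex r
    exact ⟨p, hp, Eq.trans hpr (Nat.mod_eq_of_lt (by simpa using hr))⟩
  refine ⟨h₁, hinj, hex, fun p hp n hmod => ⟨?_, fun hle => ?_⟩⟩
  · rintro ⟨i, j, k, rfl⟩
    obtain ⟨t, q, hq, h⟩ := hred j k
    have hpq : p = q := by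
      refine hinj hp hq (hmod.trans ?_)
      rw [add_assoc, h]
      simp [Nat.ModEq]
    subst hpq
    omega
  · obtain ⟨i, hi⟩ := (Nat.modEq_iff_dvd' hle).1 hmod
    exact ⟨i, p.1, p.2, by rw [mul_comm i]; omega⟩

lemma two_mul_genus_gen3 (ha : 0 < a) (hc : 0 < c) (hy : 0 < y)
    (e1 : d₁ = b * c + y * c + y * z) (e2 : d₂ = a * c + a * z + x * z)
    (e3 : d₃ = a * b + x * b + x * y) (h₁ : 0 < d₁)
    (hgcd : Nat.gcd d₁ (Nat.gcd d₂ d₃) = 1) :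
    2 * genus (gen3 d₁ d₂ d₃) + (d₁ + d₂ + d₃) =
      (a + x) * (b + y) * (c + z) + a * b * c + x * y * z + 1 := by
  have hA := (isAperyIndexing_lShape ha hc hy e1 e2 e3 h₁ hgcd).two_mul_sum
  have hw := two_mul_sum_weight e1 e2 e3
  apply Nat.eq_of_mul_eq_mul_left h₁
  linear_combination hw - hA

lemma frobeniusNum_gen3 (ha : 0 < a) (hc : 0 < c) (hy : 0 < y)
    (e1 : d₁ = b * c + y * c + y * z) (e2 : d₂ = a * c + a * z + x * z)
    (e3 : d₃ = a * b + x * b + x * y) (h₁ : 0 < d₁)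
    (hgcd : Nat.gcd d₁ (Nat.gcd d₂ d₃) = 1) (hS : ((gen3 d₁ d₂ d₃)ᶜ : Set ℕ).Nonempty) :
    frobeniusNum (gen3 d₁ d₂ d₃) + (d₁ + d₂ + d₃) =
      (a + x) * (b + y) * (c + z) + max (a * b * c) (x * y * z) := by
  have hA := isAperyIndexing_lShape ha hc hy e1 e2 e3 h₁ hgcd
  have hcorner₁ : y * d₂ + (c + z) * d₃ = (a + x) * (b + y) * (c + z) + x * y * z := by
    subst e2 e3; ring
  have hcorner₂ : (y + b) * d₂ + c * d₃ = (a + x) * (b + y) * (c + z) + a * b * c := by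
    subst e2 e3; ring
  apply le_antisymm
  · obtain ⟨⟨j, k⟩, hp, hF⟩ := hA.exists_frobeniusNum_add_le hS
    obtain ⟨hj, hk, hjk⟩ := mem_lShape.1 hp
    dsimp only at hj hk hjk hF
    have key : ∀ J K : ℕ, j + 1 ≤ J → k + 1 ≤ K →
        j * d₂ + k * d₃ + (d₂ + d₃) ≤ J * d₂ + K * d₃ := fun J K hJ hK => by
      calc _ = (j + 1) * d₂ + (k + 1) * d₃ := by ring
        _ ≤ _ := by gcongr
    rcases hjk with hjy | hkc
    · have := key y (c + z) hjy hk
      have := le_max_right (a * b * c) (x * y * z)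
      omega
    · have := key (y + b) c hj hkc
      have := le_max_left (a * b * c) (x * y * z)
      omega
  · have key : ∀ J K : ℕ, 0 < J → 0 < K → (J - 1, K - 1) ∈ lShape b c y z →
        J * d₂ + K * d₃ ≤ frobeniusNum (gen3 d₁ d₂ d₃) + (d₁ + d₂ + d₃) := fun J K hJ hK h => by
      have := hA.le_frobeniusNum_add h
      obtain ⟨J, rfl⟩ := Nat.exists_eq_add_of_lt hJ
      obtain ⟨K, rfl⟩ := Nat.exists_eq_add_of_lt hK
      simp only [zero_add, Nat.add_sub_cancel] at this ⊢
      linarith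
    have h1 := key y (c + z) hy (by omega) (mem_lShape.2 ⟨by omega, by omega, by omega⟩)
    have h2 := key (y + b) c (by omega) hc (mem_lShape.2 ⟨by omega, by omega, by omega⟩)
    rcases max_cases (a * b * c) (x * y * z) with h | h <;> omega

/-- The two syzygy degrees differ unless both products vanish. -/
lemma mul_ne_mul_of_minors (e1 : d₁ = b * c + y * c + y * z)
    (e2 : d₂ = a * c + a * z + x * z) (e3 : d₃ = a * b + x * b + x * y)
    (hgcd : Nat.gcd d₁ (Nat.gcd d₂ d₃) = 1) (hpos : 0 < x * y * z) :
    a * b * c ≠ x * y * z := by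
  intro heq
  have h1 : a * b * d₁ = d₃ * (y * z) := by
    subst e1 e3; linear_combination (b + y) * heq
  have h2 : a * b * d₂ = d₃ * (a * z) := by
    subst e2 e3; linear_combination a * heq
  have hdvd : d₃ ∣ a * b := by
    have h := Nat.dvd_gcd ⟨_, h1⟩ (Nat.dvd_gcd ⟨_, h2⟩ (Dvd.intro_left (a * b) rfl))
    rwa [Nat.gcd_mul_left, Nat.gcd_mul_left, hgcd, mul_one] at h
  have hab : 0 < a * b := Nat.pos_of_ne_zero fun h => by
    rw [h, zero_mul] at heq
    omega
  have hxy : 0 < x * y := Nat.pos_of_ne_zero fun h => by simp [h] at hpos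
  have := Nat.le_of_dvd hab hdvd
  have : 0 ≤ x * b := Nat.zero_le _
  omega

end Minors

lemma two_mul_min_le_add {p q u v : ℕ} (h : p * q = u * v) : 2 * min u v ≤ p + q := by
  have hm : min u v * min u v ≤ u * v := Nat.mul_le_mul (min_le_left _ _) (min_le_right _ _)
  by_contra! hlt
  zify at *
  nlinarith [sq_nonneg ((p : ℤ) - q)]

lemma nine_mul_min_lt {a b c x y z : ℕ} (ha : 0 < a) (hc : 0 < c) (hy : 0 < y)
    (hne : 0 < x * y * z → a * b * c ≠ x * y * z) :
    9 * min (a * b * c) (x * y * z) <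
      (a + x) * (b + y) * (c + z) + max (a * b * c) (x * y * z) := by
  have h1 := two_mul_min_le_add (show a * b * z * (x * y * c) = a * b * c * (x * y * z) by ring)
  have h2 := two_mul_min_le_add (show a * y * c * (x * b * z) = a * b * c * (x * y * z) by ring)
  have h3 := two_mul_min_le_add (show x * b * c * (a * y * z) = a * b * c * (x * y * z) by ring)
  have hP : (a + x) * (b + y) * (c + z) = a * b * c + x * y * z + (a * b * z + x * y * c) +
      (a * y * c + x * b * z) + (x * b * c + a * y * z) := by ring
  have hpos : 0 < a * y * c := by positivity
  rw [hP]
  rcases max_cases (a * b * c) (x * y * z) with h | h <;>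
    rcases min_cases (a * b * c) (x * y * z) with h' | h' <;> omega

/-- For `S₃ = ⟨d₁,d₂,d₃⟩` minimally generated, the rescaled quantity
`h₀ = K₀/g₃` with `K₀ = G₀ + (σ₁ − 1)/2` and `g₃ = F₃ + σ₁` satisfies `1/2 ≤ h₀ < 5/9`. -/
theorem h0_bounds (d₁ d₂ d₃ : ℕ) (h : MinGen3 d₁ d₂ d₃)
    (σ₁ g₃ K₀ h₀ : ℝ)
    (hσ₁ : σ₁ = (d₁ : ℝ) + d₂ + d₃)
    (hg₃ : g₃ = (frobeniusNum (gen3 d₁ d₂ d₃) : ℝ) + σ₁)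
    (hK₀ : K₀ = (genus (gen3 d₁ d₂ d₃) : ℝ) + (σ₁ - 1) / 2)
    (hh₀ : h₀ = K₀ / g₃) :
    1 / 2 ≤ h₀ ∧ h₀ < 5 / 9 := by
  obtain ⟨hd₁, h₁₂, h₂₃, -, hgcd, -⟩ := h
  have h₁ : 0 < d₁ := by omega
  obtain ⟨a, b, c, x, y, z, ha, hc, hy, e1, e2, e3⟩ :=
    exists_minors h₁ (show 0 < d₂ by omega) (show 0 < d₃ by omega)
  have hS : ((gen3 d₁ d₂ d₃)ᶜ : Set ℕ).Nonempty := by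
    refine ⟨1, ?_⟩
    rintro ⟨i, j, k, hijk⟩
    rcases i with _ | i <;> rcases j with _ | j <;> rcases k with _ | k <;>
      simp only [add_mul, zero_mul, one_mul] at hijk <;> omega
  have hG := two_mul_genus_gen3 ha hc hy e1 e2 e3 h₁ hgcd
  have hF := frobeniusNum_gen3 ha hc hy e1 e2 e3 h₁ hgcd hS
  have hlt := nine_mul_min_lt ha hc hy (mul_ne_mul_of_minors e1 e2 e3 hgcd)
  have hmm := min_add_max (a * b * c) (x * y * z)
  have hlow : frobeniusNum (gen3 d₁ d₂ d₃) + (d₁ + d₂ + d₃) + 1 ≤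
      2 * genus (gen3 d₁ d₂ d₃) + (d₁ + d₂ + d₃) := by omega
  have hupp : 9 * (2 * genus (gen3 d₁ d₂ d₃) + (d₁ + d₂ + d₃)) <
      10 * (frobeniusNum (gen3 d₁ d₂ d₃) + (d₁ + d₂ + d₃)) + 9 := by omega
  have hg₃pos : 0 < g₃ := by
    rw [hg₃, hσ₁]
    exact_mod_cast (by omega : 0 < frobeniusNum (gen3 d₁ d₂ d₃) + (d₁ + d₂ + d₃))
  have hlow' : (frobeniusNum (gen3 d₁ d₂ d₃) : ℝ) + (d₁ + d₂ + d₃) + 1 ≤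
      2 * genus (gen3 d₁ d₂ d₃) + (d₁ + d₂ + d₃) := by exact_mod_cast hlow
  have hupp' : 9 * (2 * (genus (gen3 d₁ d₂ d₃) : ℝ) + (d₁ + d₂ + d₃)) <
      10 * (frobeniusNum (gen3 d₁ d₂ d₃) + (d₁ + d₂ + d₃)) + 9 := by exact_mod_cast hupp
  rw [hh₀, le_div_iff₀ hg₃pos, div_lt_iff₀ hg₃pos]
  constructor <;> linarith
end

section
/- Let S₃ = ⟨d₁,d₂,d₃⟩ be a numerical semigroup minimally generated by three positive integers with d₁ ≥ 4, genus G₀ and conductor c₃, and suppose 3·(d₁+d₂+d₃)² < 4·d₁d₂d₃. Then G₀/c₃ < 2/3, i.e. 3·G₀ < 2·c₃. -/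
/-- The pseudo-Frobenius numbers of `⟨d₁, d₂, d₃⟩`: the gaps `p` such that `p + dᵢ` is not a gap
for each generator `dᵢ`. -/
def IsPseudoFrobenius (d₁ d₂ d₃ p : ℕ) : Prop :=
  p ∉ gen3 d₁ d₂ d₃ ∧ p + d₁ ∈ gen3 d₁ d₂ d₃ ∧ p + d₂ ∈ gen3 d₁ d₂ d₃ ∧
    p + d₃ ∈ gen3 d₁ d₂ d₃

theorem zero_mem_gen3 (d₁ d₂ d₃ : ℕ) : 0 ∈ gen3 d₁ d₂ d₃ := ⟨0, 0, 0, by simp⟩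

theorem add_mem_gen3 {d₁ d₂ d₃ m n : ℕ} (hm : m ∈ gen3 d₁ d₂ d₃) (hn : n ∈ gen3 d₁ d₂ d₃) :
    m + n ∈ gen3 d₁ d₂ d₃ := by
  obtain ⟨a, b, c, rfl⟩ := hm
  obtain ⟨a', b', c', rfl⟩ := hn
  exact ⟨a + a', b + b', c + c', by ring⟩

theorem generators_mem_gen3 (d₁ d₂ d₃ : ℕ) :
    d₁ ∈ gen3 d₁ d₂ d₃ ∧ d₂ ∈ gen3 d₁ d₂ d₃ ∧ d₃ ∈ gen3 d₁ d₂ d₃ :=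
  ⟨⟨1, 0, 0, by simp⟩, ⟨0, 1, 0, by simp⟩, ⟨0, 0, 1, by simp⟩⟩

theorem notMem_gen3_of_pos_of_lt {d₁ d₂ d₃ n : ℕ} (h₁₂ : d₁ < d₂) (h₂₃ : d₂ < d₃) (hn : 0 < n)
    (hnd : n < d₁) : n ∉ gen3 d₁ d₂ d₃ := by
  rintro ⟨a, b, c, rfl⟩
  rcases a with _ | a
  · rcases b with _ | b
    · rcases c with _ | c
      · simp at hn
      · nlinarith [Nat.zero_le (c * d₃)]
    · nlinarith [Nat.zero_le (b * d₂), Nat.zero_le (c * d₃)]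
  · nlinarith [Nat.zero_le (a * d₁), Nat.zero_le (b * d₂), Nat.zero_le (c * d₃)]

theorem finite_compl_gen3 {d₁ d₂ d₃ : ℕ} (hgcd : Nat.gcd d₁ (Nat.gcd d₂ d₃) = 1) :
    ((gen3 d₁ d₂ d₃)ᶜ : Set ℕ).Finite := by
  obtain ⟨N, hN⟩ := Nat.exists_mem_closure_of_ge ({d₁, d₂, d₃} : Set ℕ)
  have hset : Nat.setGcd ({d₁, d₂, d₃} : Set ℕ) = 1 := by
    rw [← Nat.dvd_one, ← hgcd]
    exact Nat.dvd_gcd (Nat.setGcd_dvd_of_mem (by simp))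
      (Nat.dvd_gcd (Nat.setGcd_dvd_of_mem (by simp)) (Nat.setGcd_dvd_of_mem (by simp)))
  refine (Set.finite_lt_nat N).subset fun n hn => ?_
  by_contra hlt
  have hmem := hN n (not_lt.mp hlt) (by simp [hset])
  refine hn ?_
  clear hn hlt
  induction hmem using AddSubmonoid.closure_induction with
  | mem x hx =>
    have hg := generators_mem_gen3 d₁ d₂ d₃
    rcases hx with rfl | rfl | rfl
    exacts [hg.1, hg.2.1, hg.2.2]
  | zero => exact zero_mem_gen3 d₁ d₂ d₃
  | add x y _ _ hx hy => exact add_mem_gen3 hx hy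

theorem IsPseudoFrobenius.add_mem {d₁ d₂ d₃ p s : ℕ} (hp : IsPseudoFrobenius d₁ d₂ d₃ p)
    (hs : s ∈ gen3 d₁ d₂ d₃) (hs0 : s ≠ 0) : p + s ∈ gen3 d₁ d₂ d₃ := by
  obtain ⟨-, h₁, h₂, h₃⟩ := hp
  obtain ⟨a, b, c, rfl⟩ := hs
  rcases a with _ | a
  · rcases b with _ | b
    · rcases c with _ | c
      · simp at hs0
      · convert add_mem_gen3 h₃ ⟨0, 0, c, rfl⟩ using 1
        ring
    · convert add_mem_gen3 h₂ ⟨0, b, c, rfl⟩ using 1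
      ring
  · convert add_mem_gen3 h₁ ⟨a, b, c, rfl⟩ using 1
    ring

/-- If `p` is a gap, no expression of `p + d₁` in the generators involves `d₁`; among the
expressions of `p + d₁` we pick the one with the fewest copies of `d₂`. -/
theorem IsPseudoFrobenius.exists_minimal_expr {d₁ d₂ d₃ p : ℕ}
    (hp : IsPseudoFrobenius d₁ d₂ d₃ p) :
    ∃ b c : ℕ, p + d₁ = b * d₂ + c * d₃ ∧
      ∀ b' c' : ℕ, p + d₁ = b' * d₂ + c' * d₃ → b ≤ b' := by
  classical
  have hex : ∃ b c : ℕ, p + d₁ = b * d₂ + c * d₃ := by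
    obtain ⟨a, b, c, habc⟩ := hp.2.1
    rcases a with _ | a
    · exact ⟨b, c, by simpa using habc⟩
    · exact absurd ⟨a, b, c, by linarith⟩ hp.1
  obtain ⟨c, hc⟩ := Nat.find_spec hex
  exact ⟨Nat.find hex, c, hc, fun b' c' h => Nat.find_min' hex ⟨c', h⟩⟩

theorem IsPseudoFrobenius.lt_of_expr_le {d₁ d₂ d₃ p q b c b' c' : ℕ}
    (hp : IsPseudoFrobenius d₁ d₂ d₃ p) (hq : q ∉ gen3 d₁ d₂ d₃) (hpq : p ≠ q)
    (hbc : p + d₁ = b * d₂ + c * d₃) (hbc' : q + d₁ = b' * d₂ + c' * d₃) (hb : b ≤ b') :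
    c' < c := by
  by_contra! hc
  obtain ⟨k, rfl⟩ := Nat.exists_eq_add_of_le hb
  obtain ⟨l, rfl⟩ := Nat.exists_eq_add_of_le hc
  have hsum : q = p + (k * d₂ + l * d₃) := by linarith
  have hmem : k * d₂ + l * d₃ ∈ gen3 d₁ d₂ d₃ := ⟨0, k, l, by simp⟩
  refine hq (hsum ▸ hp.add_mem hmem fun h0 => hpq ?_)
  omega

/-- Three distinct pseudo-Frobenius numbers cannot occur; the hypotheses list them by the number
of copies of `d₂` in the minimal expression of `p + d₁`. -/
theorem not_three_pseudoFrobenius_of_lt {d₁ d₂ d₃ p q r b₁ c₁ b₂ c₂ b₃ c₃ : ℕ}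
    (hp : p ∉ gen3 d₁ d₂ d₃) (hq : IsPseudoFrobenius d₁ d₂ d₃ q) (hr : r ∉ gen3 d₁ d₂ d₃)
    (h₁ : p + d₁ = b₁ * d₂ + c₁ * d₃) (h₂ : q + d₁ = b₂ * d₂ + c₂ * d₃)
    (h₃ : r + d₁ = b₃ * d₂ + c₃ * d₃)
    (hmin : ∀ b' c' : ℕ, r + d₁ = b' * d₂ + c' * d₃ → b₃ ≤ b')
    (hb₂₃ : b₂ < b₃) (hc₁₂ : c₂ < c₁) : False := by
  -- Expressions of `B d₂` with `B ≤ b₃`, or of `C d₃` with `C ≤ c₁`, cannot involve `d₁`.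
  have keyB : ∀ B a c : ℕ, B ≤ b₃ → B * d₂ = (a + 1) * d₁ + c * d₃ → False := by
    intro B a c hB he
    obtain ⟨k, rfl⟩ := Nat.exists_eq_add_of_le hB
    exact hr ⟨a, k, c + c₃, by linarith⟩
  have keyC : ∀ C a b : ℕ, C ≤ c₁ → C * d₃ = (a + 1) * d₁ + b * d₂ → False := by
    intro C a b hC he
    obtain ⟨k, rfl⟩ := Nat.exists_eq_add_of_le hC
    exact hp ⟨a, b + b₁, k, by linarith⟩
  obtain ⟨hq0, -, ⟨a, b, c, hq₂⟩, ⟨a', b', c', hq₃⟩⟩ := hq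
  rcases b with _ | b
  swap
  · exact hq0 ⟨a, b, c, by linarith⟩
  rcases c' with _ | c'
  swap
  · exact hq0 ⟨a', b', c', by linarith⟩
  rcases le_or_gt c₂ c with hc | hc
  · obtain ⟨k, rfl⟩ := Nat.exists_eq_add_of_le hc
    exact keyB (b₂ + 1) a k hb₂₃ (by linarith)
  rcases le_or_gt b₂ b' with hb | hb
  · obtain ⟨k, rfl⟩ := Nat.exists_eq_add_of_le hb
    exact keyC (c₂ + 1) a' k hc₁₂ (by linarith)
  -- `(b' + 1) d₂ + a d₁ = (c + 1) d₃ + a' d₁`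
  rcases lt_trichotomy a a' with haa | rfl | haa
  · obtain ⟨k, rfl⟩ := Nat.exists_eq_add_of_lt haa
    exact keyC (c + 1) k (b' + 1) (by omega) (by linarith)
  · obtain ⟨k, rfl⟩ := Nat.exists_eq_add_of_lt (hb.trans hb₂₃)
    have := hmin k (c₃ + c + 1) (by linarith)
    omega
  · obtain ⟨k, rfl⟩ := Nat.exists_eq_add_of_lt haa
    exact keyB (b' + 1) k (c + 1) (by omega) (by linarith)

/-- A numerical semigroup with three generators has type at most two. -/
theorem not_three_pseudoFrobenius {d₁ d₂ d₃ p q r : ℕ} (hp : IsPseudoFrobenius d₁ d₂ d₃ p)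
    (hq : IsPseudoFrobenius d₁ d₂ d₃ q) (hr : IsPseudoFrobenius d₁ d₂ d₃ r)
    (hpq : p ≠ q) (hpr : p ≠ r) (hqr : q ≠ r) : False := by
  obtain ⟨b₁, c₁, h₁, m₁⟩ := hp.exists_minimal_expr
  obtain ⟨b₂, c₂, h₂, m₂⟩ := hq.exists_minimal_expr
  obtain ⟨b₃, c₃, h₃, m₃⟩ := hr.exists_minimal_expr
  have l₁₂ := hp.lt_of_expr_le hq.1 hpq h₁ h₂
  have l₂₁ := hq.lt_of_expr_le hp.1 hpq.symm h₂ h₁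
  have l₁₃ := hp.lt_of_expr_le hr.1 hpr h₁ h₃
  have l₃₁ := hr.lt_of_expr_le hp.1 hpr.symm h₃ h₁
  have l₂₃ := hq.lt_of_expr_le hr.1 hqr h₂ h₃
  have l₃₂ := hr.lt_of_expr_le hq.1 hqr.symm h₃ h₂
  have t₁₂₃ := not_three_pseudoFrobenius_of_lt hp.1 hq hr.1 h₁ h₂ h₃ m₃
  have t₁₃₂ := not_three_pseudoFrobenius_of_lt hp.1 hr hq.1 h₁ h₃ h₂ m₂
  have t₂₁₃ := not_three_pseudoFrobenius_of_lt hq.1 hp hr.1 h₂ h₁ h₃ m₃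
  have t₂₃₁ := not_three_pseudoFrobenius_of_lt hq.1 hr hp.1 h₂ h₃ h₁ m₁
  have t₃₁₂ := not_three_pseudoFrobenius_of_lt hr.1 hp hq.1 h₃ h₁ h₂ m₂
  have t₃₂₁ := not_three_pseudoFrobenius_of_lt hr.1 hq hp.1 h₃ h₂ h₁ m₁
  grind

theorem exists_pseudoFrobenius_of_gap {d₁ d₂ d₃ F x : ℕ} (h₁ : 0 < d₁) (h₂ : 0 < d₂)
    (h₃ : 0 < d₃) (hF : ∀ n, F < n → n ∈ gen3 d₁ d₂ d₃) (hx : x ∉ gen3 d₁ d₂ d₃) :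
    ∃ p, IsPseudoFrobenius d₁ d₂ d₃ p ∧ ∃ s ∈ gen3 d₁ d₂ d₃, x + s = p := by
  induction hk : F - x using Nat.strong_induction_on generalizing x with
  | _ k ih =>
    have step : ∀ d ∈ gen3 d₁ d₂ d₃, 0 < d → x + d ∉ gen3 d₁ d₂ d₃ →
        ∃ p, IsPseudoFrobenius d₁ d₂ d₃ p ∧ ∃ s ∈ gen3 d₁ d₂ d₃, x + s = p := by
      intro d hd hd0 hxd
      have hle : x + d ≤ F := not_lt.mp fun hlt => hxd (hF _ hlt)
      obtain ⟨p, hp, s, hs, hsum⟩ := ih (F - (x + d)) (by omega) hxd rfl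
      exact ⟨p, hp, d + s, add_mem_gen3 hd hs, by omega⟩
    obtain ⟨g₁, g₂, g₃⟩ := generators_mem_gen3 d₁ d₂ d₃
    by_cases m₁ : x + d₁ ∈ gen3 d₁ d₂ d₃
    · by_cases m₂ : x + d₂ ∈ gen3 d₁ d₂ d₃
      · by_cases m₃ : x + d₃ ∈ gen3 d₁ d₂ d₃
        · exact ⟨x, ⟨hx, m₁, m₂, m₃⟩, 0, zero_mem_gen3 d₁ d₂ d₃, rfl⟩
        · exact step d₃ g₃ h₃ m₃
      · exact step d₂ g₂ h₂ m₂
    · exact step d₁ g₁ h₁ m₁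

/-- All gaps lie below the Frobenius number `F` or below a second gap `f`. -/
theorem exists_second_pseudoFrobenius {d₁ d₂ d₃ F : ℕ} (h₁ : 0 < d₁) (h₂ : 0 < d₂)
    (h₃ : 0 < d₃) (hF0 : F ∉ gen3 d₁ d₂ d₃) (hF : ∀ n, F < n → n ∈ gen3 d₁ d₂ d₃) :
    ∃ f ≤ F, f ∉ gen3 d₁ d₂ d₃ ∧
      ∀ x ∉ gen3 d₁ d₂ d₃, ∃ s ∈ gen3 d₁ d₂ d₃, x + s = F ∨ x + s = f := by
  have hPF : IsPseudoFrobenius d₁ d₂ d₃ F :=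
    ⟨hF0, hF _ (by omega), hF _ (by omega), hF _ (by omega)⟩
  by_cases hex : ∃ f, IsPseudoFrobenius d₁ d₂ d₃ f ∧ f ≠ F
  · obtain ⟨f, hf, hne⟩ := hex
    refine ⟨f, not_lt.mp fun hlt => hf.1 (hF _ hlt), hf.1, fun x hx => ?_⟩
    obtain ⟨p, hp, s, hs, hsum⟩ := exists_pseudoFrobenius_of_gap h₁ h₂ h₃ hF hx
    refine ⟨s, hs, ?_⟩
    by_contra! hcon
    exact not_three_pseudoFrobenius hp hPF hf (hsum ▸ hcon.1) (hsum ▸ hcon.2) hne.symm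
  · push Not at hex
    refine ⟨F, le_rfl, hF0, fun x hx => ?_⟩
    obtain ⟨p, hp, s, hs, hsum⟩ := exists_pseudoFrobenius_of_gap h₁ h₂ h₃ hF hx
    exact ⟨s, hs, Or.inl (hsum.trans (hex p hp))⟩

/-- If every gap of `S` has the form `F - s` or `f - s` with `s ∈ S`, then `S` has at most twice as
many gaps as elements up to `F`; equality would force `2 ∈ S` or `3 ∈ S`. -/
theorem card_gaps_lt_two_mul {S : Set ℕ} [DecidablePred (· ∈ S)] {F f : ℕ} (h0 : 0 ∈ S)
    (h1 : 1 ∉ S) (h2 : 2 ∉ S) (h3 : 3 ∉ S) (hF0 : F ∉ S) (hF : ∀ n, F < n → n ∈ S)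
    (hfF : f ≤ F) (hf0 : f ∉ S)
    (hgap : ∀ x ∉ S, ∃ s ∈ S, x + s = F ∨ x + s = f) :
    ((Finset.range (F + 1)).filter (· ∉ S)).card <
      2 * ((Finset.range (F + 1)).filter (· ∈ S)).card := by
  set N := (Finset.range (F + 1)).filter (· ∈ S)
  have memN : ∀ s, s ∈ N ↔ s ≤ F ∧ s ∈ S := by simp [N]
  set A := N.image (F - ·)
  set B := (N.filter (· ≤ f)).image (f - ·)
  have hsub : (Finset.range (F + 1)).filter (· ∉ S) ⊆ A ∪ B := by
    intro x hx
    obtain ⟨s, hs, hsum⟩ := hgap x (Finset.mem_filter.mp hx).2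
    rcases hsum with hsum | hsum
    · exact Finset.mem_union_left _
        (Finset.mem_image.mpr ⟨s, (memN s).mpr ⟨by omega, hs⟩, by omega⟩)
    · exact Finset.mem_union_right _ (Finset.mem_image.mpr
        ⟨s, Finset.mem_filter.mpr ⟨(memN s).mpr ⟨by omega, hs⟩, by omega⟩, by omega⟩)
  have hle := Finset.card_le_card hsub
  have hAB := Finset.card_union_add_card_inter A B
  have hA : A.card ≤ N.card := Finset.card_image_le
  have hBf : B.card ≤ (N.filter (· ≤ f)).card := Finset.card_image_le
  have hfN : (N.filter (· ≤ f)).card ≤ N.card := Finset.card_filter_le _ _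
  by_contra! hge
  have hinter : A ∩ B = ∅ := Finset.card_eq_zero.mp (by omega)
  have hfilter : N.filter (· ≤ f) = N :=
    Finset.eq_of_subset_of_card_le (Finset.filter_subset _ _) (by omega)
  have below : ∀ s ∈ S, s ≤ F → s ≤ f := fun s hs hsF =>
    Finset.filter_eq_self.mp hfilter _ ((memN s).mpr ⟨hsF, hs⟩)
  have disj : ∀ s ∈ S, ∀ t ∈ S, t ≤ F → s ≤ f → F - t ≠ f - s := by
    intro s hs t ht htF hsf he
    refine Finset.notMem_empty (F - t) (hinter ▸ Finset.mem_inter.mpr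
      ⟨Finset.mem_image_of_mem _ ((memN t).mpr ⟨htF, ht⟩), Finset.mem_image.mpr
        ⟨s, Finset.mem_filter.mpr ⟨(memN s).mpr ⟨by omega, hs⟩, hsf⟩, he.symm⟩⟩)
  have hF3 : 3 ≤ F := not_lt.mp fun hlt => h3 (hF _ hlt)
  have hfne : f ≠ F := fun he => disj 0 h0 0 h0 (Nat.zero_le _) (Nat.zero_le _) (by omega)
  have hpred : F - 1 ∉ S := fun hmem => by
    have := below _ hmem (by omega)
    exact hf0 ((show f = F - 1 by omega) ▸ hmem)
  obtain rfl : F = f + 1 := by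
    obtain ⟨s, hs, hsum⟩ := hgap _ hpred
    rcases hsum with hsum | hsum
    · exact absurd ((show s = 1 by omega) ▸ hs) h1
    · omega
  have hmem : f - 1 ∈ S := by
    obtain ⟨s, hs, hsum⟩ := hgap 1 h1
    rcases hsum with hsum | hsum
    · exact absurd ((show s = f by omega) ▸ hs) hf0
    · exact (show s = f - 1 by omega) ▸ hs
  have hnot : f - 2 ∉ S := fun h => disj _ h _ hmem (by omega) (by omega) (by omega)
  obtain ⟨s, hs, hsum⟩ := hgap _ hnot
  rcases hsum with hsum | hsum
  · exact h3 ((show s = 3 by omega) ▸ hs)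
  · exact h2 ((show s = 2 by omega) ▸ hs)

theorem conductorNum_eq_succ {S : Set ℕ} {F : ℕ} (hF0 : F ∉ S) (hF : ∀ n, F < n → n ∈ S) :
    conductorNum S = F + 1 := by
  refine le_antisymm (Nat.sInf_le fun n hn => hF n hn) ?_
  refine le_csInf ⟨F + 1, fun n hn => hF n hn⟩ fun c hc => ?_
  by_contra! hlt
  exact hF0 (hc F (by omega))

theorem genus_eq_card_filter {S : Set ℕ} [DecidablePred (· ∈ S)] {F : ℕ}
    (hF : ∀ n, F < n → n ∈ S) :
    genus S = ((Finset.range (F + 1)).filter (· ∉ S)).card := by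
  rw [genus, ← Set.ncard_coe_finset]
  congr 1
  ext n
  simp only [Set.mem_compl_iff, Finset.coe_filter, Finset.mem_range, Set.mem_ofPred_eq]
  exact ⟨fun hn => ⟨Nat.lt_succ_of_le (not_lt.mp fun hlt => hn (hF n hlt)), hn⟩, And.right⟩

theorem three_mul_genus_lt_two_mul_conductorNum {d₁ d₂ d₃ : ℕ} (h₁₂ : d₁ < d₂) (h₂₃ : d₂ < d₃)
    (hgcd : Nat.gcd d₁ (Nat.gcd d₂ d₃) = 1) (h4 : 4 ≤ d₁) :
    3 * genus (gen3 d₁ d₂ d₃) < 2 * conductorNum (gen3 d₁ d₂ d₃) := by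
  classical
  have small : ∀ n, 0 < n → n < 4 → n ∉ gen3 d₁ d₂ d₃ := fun n hn hn4 =>
    notMem_gen3_of_pos_of_lt h₁₂ h₂₃ hn (by omega)
  obtain ⟨F, hF0, hmax⟩ := Set.exists_max_image _ id (finite_compl_gen3 hgcd)
    ⟨1, small 1 (by omega) (by omega)⟩
  have hF : ∀ n, F < n → n ∈ gen3 d₁ d₂ d₃ := fun n hn => by
    by_contra hgap
    exact absurd (hmax n hgap) (not_le.mpr hn)
  obtain ⟨f, hfF, hf0, hgap⟩ :=
    exists_second_pseudoFrobenius (by omega) (by omega) (by omega) hF0 hF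
  have hlt := card_gaps_lt_two_mul (zero_mem_gen3 d₁ d₂ d₃) (small 1 (by omega) (by omega))
    (small 2 (by omega) (by omega)) (small 3 (by omega) (by omega)) hF0 hF hfF hf0 hgap
  have hsum := Finset.card_filter_add_card_filter_not (s := Finset.range (F + 1))
    (· ∈ gen3 d₁ d₂ d₃)
  rw [Finset.card_range] at hsum
  rw [conductorNum_eq_succ hF0 hF, genus_eq_card_filter hF]
  omega

/-- If `S₃ = ⟨d₁,d₂,d₃⟩` is minimally generated with `d₁ ≥ 4` and
`3·(d₁+d₂+d₃)² < 4·d₁d₂d₃`, then `G₀/c₃ < 2/3`, i.e. `3·G₀ < 2·c₃`. -/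
theorem wilf_strict (d₁ d₂ d₃ : ℕ) (h : MinGen3 d₁ d₂ d₃) (h4 : 4 ≤ d₁)
    (hρ : 3 * (d₁ + d₂ + d₃) ^ 2 < 4 * (d₁ * d₂ * d₃)) :
    3 * genus (gen3 d₁ d₂ d₃) < 2 * conductorNum (gen3 d₁ d₂ d₃) ∧
      (genus (gen3 d₁ d₂ d₃) : ℚ) / (conductorNum (gen3 d₁ d₂ d₃) : ℚ) < 2 / 3 := by
  have key := three_mul_genus_lt_two_mul_conductorNum h.2.1 h.2.2.1 h.2.2.2.2.1 h4
  refine ⟨key, ?_⟩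
  have hc : (0 : ℚ) < conductorNum (gen3 d₁ d₂ d₃) := by
    exact_mod_cast (by omega : 0 < conductorNum (gen3 d₁ d₂ d₃))
  have hq : (3 : ℚ) * genus (gen3 d₁ d₂ d₃) < 2 * conductorNum (gen3 d₁ d₂ d₃) := by
    exact_mod_cast key
  rw [div_lt_iff₀ hc]
  linarith
end

section
/- Let S₃ = ⟨d₁,d₂,d₃⟩ be a non-symmetric numerical semigroup minimally generated by three positive integers. Then the rescaled genus h₂ = K₂/g₃³ satisfies 1/18 < h₂ < 1/9. -/
/-- If a down-closed set of pairs `D` is a transversal of the fibres of `(b, c) ↦ b • u + c • v`,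
then every minimal non-element of `D` off the axes lies over `0`. -/
lemma corner_eq_zero {G : Type*} [AddCommGroup G] {u v : G} {D : ℕ → ℕ → Prop}
    (down : ∀ b c b' c', D b c → b' ≤ b → c' ≤ c → D b' c')
    (uniq : ∀ b c b' c', D b c → D b' c' → b • u + c • v = b' • u + c' • v → b = b' ∧ c = c')
    (ex : ∀ b c : ℕ, ∃ b' c' : ℕ, D b' c' ∧ b' • u + c' • v = b • u + c • v)
    {b c : ℕ} (h : ¬ D (b + 1) (c + 1)) (h₁ : D b (c + 1)) (h₂ : D (b + 1) c) :
    (b + 1) • u + (c + 1) • v = 0 := by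
  obtain ⟨b', c', hD, e⟩ := ex (b + 1) (c + 1)
  rcases b' with _ | b'
  · rcases c' with _ | c'
    · rw [← e]; simp
    · exfalso
      have hD' : D 0 c' := down _ _ _ _ hD le_rfl (Nat.le_succ _)
      have := uniq _ _ _ _ hD' h₂ (by
        rw [succ_nsmul v c', succ_nsmul v c, ← add_assoc, ← add_assoc] at e
        exact add_right_cancel e)
      omega
  · exfalso
    have hD' : D b' c' := down _ _ _ _ hD (Nat.le_succ _) le_rfl
    have := uniq _ _ _ _ hD' h₁ (by
      rw [succ_nsmul' u b', succ_nsmul' u b, add_assoc, add_assoc] at e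
      exact add_left_cancel e)
    obtain ⟨rfl, rfl⟩ := this
    exact h hD

/-- A down-closed transversal of the fibres of `(b, c) ↦ b • u + c • v` in a finite group is
L-shaped. -/
lemma exists_lShape {G : Type*} [AddCommGroup G] [Finite G] {u v : G} {D : ℕ → ℕ → Prop}
    (down : ∀ b c b' c', D b c → b' ≤ b → c' ≤ c → D b' c')
    (uniq : ∀ b c b' c', D b c → D b' c' → b • u + c • v = b' • u + c' • v → b = b' ∧ c = c')
    (ex : ∀ b c : ℕ, ∃ b' c' : ℕ, D b' c' ∧ b' • u + c' • v = b • u + c • v) :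
    ∃ r₂ e₂ r₃ e₃ : ℕ, 0 < r₂ ∧ 0 < r₃ ∧
      (∀ b c, D b c ↔ (b < r₂ ∧ c < r₃ + e₃) ∨ (r₂ ≤ b ∧ b < r₂ + e₂ ∧ c < r₃)) ∧
      ((e₂ = 0 ∧ e₃ = 0) ∨ ((r₂ + e₂) • u = e₃ • v ∧ (r₃ + e₃) • v = e₂ • u)) := by
  classical
  have h00 : D 0 0 := by
    obtain ⟨b, c, h, -⟩ := ex 0 0
    exact down _ _ _ _ h (Nat.zero_le _) (Nat.zero_le _)
  have hB : ∃ b, ¬ D b 0 := by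
    by_contra! hall
    refine not_injective_infinite_finite (fun b : ℕ => b • u) fun b b' e => ?_
    exact (uniq _ _ _ _ (hall b) (hall b') (by simpa using e)).1
  have hC : ∃ c, ¬ D 0 c := by
    by_contra! hall
    refine not_injective_infinite_finite (fun c : ℕ => c • v) fun c c' e => ?_
    exact (uniq _ _ _ _ (hall c) (hall c') (by simpa using e)).2
  obtain ⟨B, hB₁, hB₂⟩ : ∃ B, ¬ D B 0 ∧ ∀ b < B, D b 0 :=
    ⟨Nat.find hB, Nat.find_spec hB, fun b hb => not_not.1 (Nat.find_min hB hb)⟩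
  obtain ⟨C, hC₁, hC₂⟩ : ∃ C, ¬ D 0 C ∧ ∀ c < C, D 0 c :=
    ⟨Nat.find hC, Nat.find_spec hC, fun b hb => not_not.1 (Nat.find_min hC hb)⟩
  have hBpos : 0 < B := Nat.pos_of_ne_zero fun h => hB₁ (h ▸ h00)
  have hCpos : 0 < C := Nat.pos_of_ne_zero fun h => hC₁ (h ▸ h00)
  have ltB : ∀ b c, D b c → b < B := fun b c h => by
    by_contra! hb
    exact hB₁ (down _ _ _ _ h hb (Nat.zero_le _))
  have ltC : ∀ b c, D b c → c < C := fun b c h => by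
    by_contra! hc
    exact hC₁ (down _ _ _ _ h (Nat.zero_le _) hc)
  by_cases hrect : ∀ b < B, ∀ c < C, D b c
  · refine ⟨B, 0, C, 0, hBpos, hCpos, fun b c => ⟨fun h => ?_, fun h => ?_⟩, Or.inl ⟨rfl, rfl⟩⟩
    · exact Or.inl ⟨ltB _ _ h, ltC _ _ h⟩
    · rcases h with h | h
      · exact hrect _ h.1 _ h.2
      · omega
  push Not at hrect
  have hR : ∃ b, b < B ∧ ∃ c, c < C ∧ ¬ D b c := by
    obtain ⟨b, hb, c, hc, h⟩ := hrect
    exact ⟨b, hb, c, hc, h⟩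
  obtain ⟨r₂, hr₂B, ⟨c₀, hc₀⟩, hr₂min⟩ :
      ∃ r, r < B ∧ (∃ c, c < C ∧ ¬ D r c) ∧ ∀ b < r, ∀ c < C, D b c := by
    refine ⟨Nat.find hR, (Nat.find_spec hR).1, (Nat.find_spec hR).2, fun b hb c hc => ?_⟩
    have := Nat.find_min hR hb
    by_contra hD
    exact this ⟨hb.trans (Nat.find_spec hR).1, c, hc, hD⟩
  obtain ⟨r₃, hr₃, hr₃min⟩ : ∃ r, ¬ D r₂ r ∧ ∀ c < r, D r₂ c := by
    have hE : ∃ c, ¬ D r₂ c := ⟨c₀, hc₀.2⟩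
    exact ⟨Nat.find hE, Nat.find_spec hE, fun b hb => not_not.1 (Nat.find_min hE hb)⟩
  have hr₃C : r₃ < C := by
    by_contra! h
    exact hc₀.2 (hr₃min _ (hc₀.1.trans_le h))
  have hr₂pos : 0 < r₂ := Nat.pos_of_ne_zero fun h => hr₃ (h ▸ hC₂ _ hr₃C)
  have hr₃pos : 0 < r₃ := Nat.pos_of_ne_zero fun h => hr₃ (h ▸ hB₂ _ hr₂B)
  have hzero : r₂ • u + r₃ • v = 0 := by
    obtain ⟨b, rfl⟩ : ∃ b, r₂ = b + 1 := ⟨r₂ - 1, by omega⟩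
    obtain ⟨c, rfl⟩ : ∃ c, r₃ = c + 1 := ⟨r₃ - 1, by omega⟩
    exact corner_eq_zero down uniq ex hr₃ (hr₂min _ (Nat.lt_succ_self _) _ hr₃C)
      (hr₃min _ (Nat.lt_succ_self _))
  have hlow : ∀ b < B, ∀ c < r₃, D b c := by
    by_contra! hne
    have hE : ∃ b, b < B ∧ ∃ c, c < r₃ ∧ ¬ D b c := by
      obtain ⟨b, hb, c, hc, h⟩ := hne
      exact ⟨b, hb, c, hc, h⟩
    obtain ⟨s, hsB, ⟨c₁, hc₁⟩, hsmin⟩ :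
        ∃ r, r < B ∧ (∃ c, c < r₃ ∧ ¬ D r c) ∧ ∀ b < r, ∀ c < r₃, D b c := by
      refine ⟨Nat.find hE, (Nat.find_spec hE).1, (Nat.find_spec hE).2, fun b hb c hc => ?_⟩
      have := Nat.find_min hE hb
      by_contra hD
      exact this ⟨hb.trans (Nat.find_spec hE).1, c, hc, hD⟩
    obtain ⟨t, ht, htmin⟩ : ∃ r, ¬ D s r ∧ ∀ c < r, D s c := by
      have hE : ∃ c, ¬ D s c := ⟨c₁, hc₁.2⟩
      exact ⟨Nat.find hE, Nat.find_spec hE, fun b hb => not_not.1 (Nat.find_min hE hb)⟩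
    have htr : t < r₃ := by
      by_contra! h
      exact hc₁.2 (htmin _ (hc₁.1.trans_le h))
    have hrs : r₂ < s := by
      by_contra! h
      exact ht (down _ _ _ _ (hr₃min _ htr) h le_rfl)
    have htpos : 0 < t := Nat.pos_of_ne_zero fun h => ht (h ▸ hB₂ _ hsB)
    have hst : s • u + t • v = 0 := by
      obtain ⟨b, rfl⟩ : ∃ b, s = b + 1 := ⟨s - 1, by omega⟩
      obtain ⟨c, rfl⟩ : ∃ c, t = c + 1 := ⟨t - 1, by omega⟩
      exact corner_eq_zero down uniq ex ht (hsmin _ (Nat.lt_succ_self _) _ htr)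
        (htmin _ (Nat.lt_succ_self _))
    obtain ⟨m, rfl⟩ : ∃ m, s = r₂ + m := ⟨s - r₂, by omega⟩
    obtain ⟨k, rfl⟩ : ∃ k, r₃ = t + k := ⟨r₃ - t, by omega⟩
    have := uniq m 0 0 k (hB₂ _ (by omega)) (hC₂ _ (by omega)) (by
      have h := hst.trans hzero.symm
      rw [add_nsmul, add_nsmul] at h
      simp only [zero_nsmul, add_zero, zero_add]
      have h' : (r₂ • u + t • v) + m • u = (r₂ • u + t • v) + k • v := by
        rw [← sub_eq_zero] at h ⊢
        rw [← h]; abel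
      exact add_left_cancel h')
    omega
  obtain ⟨e₂, rfl⟩ : ∃ m, B = r₂ + m := ⟨B - r₂, by omega⟩
  obtain ⟨e₃, rfl⟩ : ∃ m, C = r₃ + m := ⟨C - r₃, by omega⟩
  have key : (r₂ + e₂) • u = e₃ • v ∧ (r₃ + e₃) • v = e₂ • u := by
    obtain ⟨b', hb', hbe⟩ : ∃ b', b' < r₂ + e₂ ∧ b' • u = (r₃ + e₃) • v := by
      obtain ⟨b', c', hD, e⟩ := ex 0 (r₃ + e₃)
      rcases c' with _ | c'
      · exact ⟨b', ltB _ _ hD, by simpa using e⟩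
      · exfalso
        obtain ⟨c, hc⟩ : ∃ c, r₃ + e₃ = c + 1 := ⟨r₃ + e₃ - 1, by omega⟩
        have hD' : D b' c' := down _ _ _ _ hD le_rfl (Nat.le_succ _)
        have hc' := ltC _ _ hD
        have := uniq _ _ _ _ hD' (hC₂ c (by omega)) (by
          rw [hc, succ_nsmul v c', succ_nsmul v c, ← add_assoc, ← add_assoc] at e
          exact add_right_cancel e)
        omega
    obtain ⟨c', hc', hce⟩ : ∃ c', c' < r₃ + e₃ ∧ c' • v = (r₂ + e₂) • u := by
      obtain ⟨b', c', hD, e⟩ := ex (r₂ + e₂) 0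
      rcases b' with _ | b'
      · exact ⟨c', ltC _ _ hD, by simpa using e⟩
      · exfalso
        obtain ⟨c, hc⟩ : ∃ c, r₂ + e₂ = c + 1 := ⟨r₂ + e₂ - 1, by omega⟩
        have hD' : D b' c' := down _ _ _ _ hD (Nat.le_succ _) le_rfl
        have hc' := ltB _ _ hD
        have := uniq _ _ _ _ hD' (hB₂ c (by omega)) (by
          rw [hc, succ_nsmul' u b', succ_nsmul' u c, add_assoc, add_assoc] at e
          exact add_left_cancel e)
        omega
    have h₁ : (b' + r₂) • u = e₃ • v := by
      rw [add_nsmul, hbe, add_nsmul, ← sub_eq_zero, ← hzero]; abel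
    have hge : r₂ + e₂ ≤ b' + r₂ := by
      by_contra! hlt
      have := uniq (b' + r₂) 0 0 e₃ (hB₂ _ hlt) (hC₂ _ (by omega)) (by simpa using h₁)
      omega
    have heq : b' + r₂ = r₂ + e₂ := by
      obtain ⟨m, hm⟩ : ∃ m, b' + r₂ = m + (r₂ + e₂) := ⟨b' - e₂, by omega⟩
      have h₂ : m • u + c' • v = e₃ • v := by rw [← h₁, hm, add_nsmul, hce]
      rcases le_total c' e₃ with hle | hle
      · obtain ⟨k, rfl⟩ := Nat.exists_eq_add_of_le hle
        have := uniq m 0 0 k (hB₂ _ (by omega)) (hC₂ _ (by omega)) (by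
          rw [add_nsmul v c' k, add_comm (c' • v)] at h₂
          simpa using add_right_cancel h₂)
        omega
      · obtain ⟨k, rfl⟩ := Nat.exists_eq_add_of_le hle
        have := uniq m k 0 0 (hr₂min _ (by omega) _ (by omega)) h00 (by
          rw [add_nsmul v e₃ k, add_comm (e₃ • v), ← add_assoc] at h₂
          simpa using h₂)
        omega
    obtain rfl : b' = e₂ := by omega
    exact ⟨by rw [← heq, h₁], hbe.symm⟩
  refine ⟨r₂, e₂, r₃, e₃, hr₂pos, hr₃pos, fun b c => ⟨fun h => ?_, fun h => ?_⟩, Or.inr key⟩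
  · have h₁ := ltB _ _ h
    have h₂ := ltC _ _ h
    by_contra hcon
    exact hr₃ (down _ _ _ _ h (by omega) (by omega))
  · rcases h with h | h
    · exact hr₂min _ h.1 _ h.2
    · exact hlow _ h.2.1 _ h.2.2

/-- `(b, c)` is the distinguished factorization `b * d₂ + c * d₃` of an Apéry element of
`⟨d₁, d₂, d₃⟩` with respect to `d₁`: it has least weight in its residue class modulo `d₁`, and least
second coordinate among the pairs of that weight. -/
def IsAperyPair (d₁ d₂ d₃ b c : ℕ) : Prop :=
  ∀ b' c' : ℕ, b' * d₂ + c' * d₃ ≡ b * d₂ + c * d₃ [MOD d₁] →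
    b * d₂ + c * d₃ < b' * d₂ + c' * d₃ ∨ (b * d₂ + c * d₃ = b' * d₂ + c' * d₃ ∧ c ≤ c')

lemma IsAperyPair.weight_le {d₁ d₂ d₃ b c : ℕ} (h : IsAperyPair d₁ d₂ d₃ b c) {b' c' : ℕ}
    (e : b' * d₂ + c' * d₃ ≡ b * d₂ + c * d₃ [MOD d₁]) :
    b * d₂ + c * d₃ ≤ b' * d₂ + c' * d₃ := by
  rcases h b' c' e with h | h
  · exact h.le
  · exact h.1.le

lemma IsAperyPair.down {d₁ d₂ d₃ b c : ℕ} (h : IsAperyPair d₁ d₂ d₃ b c) {b' c' : ℕ}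
    (hb : b' ≤ b) (hc : c' ≤ c) : IsAperyPair d₁ d₂ d₃ b' c' := by
  obtain ⟨m, rfl⟩ := Nat.exists_eq_add_of_le hb
  obtain ⟨k, rfl⟩ := Nat.exists_eq_add_of_le hc
  intro s t e
  have := h (s + m) (t + k) (by
    have := e.add_right (m * d₂ + k * d₃)
    convert this using 1 <;> ring)
  simp only [add_mul] at this
  omega

lemma IsAperyPair.unique {d₁ d₂ d₃ b c b' c' : ℕ} (hd₂ : 0 < d₂) (h : IsAperyPair d₁ d₂ d₃ b c)
    (h' : IsAperyPair d₁ d₂ d₃ b' c') (e : b * d₂ + c * d₃ ≡ b' * d₂ + c' * d₃ [MOD d₁]) :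
    b = b' ∧ c = c' := by
  have h₁ := h b' c' e.symm
  have h₂ := h' b c e
  obtain rfl : c = c' := by omega
  exact ⟨Nat.eq_of_mul_eq_mul_right hd₂ (by omega), rfl⟩

lemma exists_isAperyPair (d₁ d₂ d₃ b c : ℕ) :
    ∃ b' c', IsAperyPair d₁ d₂ d₃ b' c' ∧ b' * d₂ + c' * d₃ ≡ b * d₂ + c * d₃ [MOD d₁] := by
  classical
  have hw : ∃ w b' c', w = b' * d₂ + c' * d₃ ∧ w ≡ b * d₂ + c * d₃ [MOD d₁] :=
    ⟨_, b, c, rfl, rfl⟩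
  have hc : ∃ c' b', Nat.find hw = b' * d₂ + c' * d₃ := by
    obtain ⟨b', c', h, -⟩ := Nat.find_spec hw
    exact ⟨c', b', h⟩
  have hmod : Nat.find hw ≡ b * d₂ + c * d₃ [MOD d₁] := by
    obtain ⟨b', c', -, h⟩ := Nat.find_spec hw
    exact h
  obtain ⟨b', hb'⟩ := Nat.find_spec hc
  refine ⟨b', Nat.find hc, fun s t e => ?_, hb' ▸ hmod⟩
  rw [← hb'] at e ⊢
  rcases (Nat.find_min' hw ⟨s, t, rfl, e.trans hmod⟩).lt_or_eq with h | h
  · exact Or.inl h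
  · exact Or.inr ⟨h, Nat.find_min' hc ⟨s, h⟩⟩

lemma exists_modEq_of_gcd_eq_one {d₁ d₂ d₃ : ℕ} (hd₁ : 0 < d₁)
    (hgcd : Nat.gcd d₁ (Nat.gcd d₂ d₃) = 1) (n : ℕ) :
    ∃ b c, b * d₂ + c * d₃ ≡ n [MOD d₁] := by
  have : NeZero d₁ := ⟨hd₁.ne'⟩
  have hu : IsUnit ((Nat.gcd d₂ d₃ : ℕ) : ZMod d₁) :=
    (ZMod.isUnit_iff_coprime _ _).2 (Nat.coprime_comm.1 hgcd)
  obtain ⟨z, hz⟩ := hu.exists_right_inv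
  have hbez : ((Nat.gcd d₂ d₃ : ℕ) : ZMod d₁) =
      d₂ * (Nat.gcdA d₂ d₃ : ZMod d₁) + d₃ * (Nat.gcdB d₂ d₃ : ZMod d₁) := by
    have := congrArg (Int.cast : ℤ → ZMod d₁) (Nat.gcd_eq_gcd_ab d₂ d₃)
    push_cast at this
    exact this
  refine ⟨((n : ZMod d₁) * z * (Nat.gcdA d₂ d₃ : ZMod d₁)).val,
    ((n : ZMod d₁) * z * (Nat.gcdB d₂ d₃ : ZMod d₁)).val, ?_⟩
  rw [← ZMod.natCast_eq_natCast_iff]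
  push_cast
  rw [ZMod.natCast_zmod_val, ZMod.natCast_zmod_val]
  rw [hbez] at hz
  linear_combination (n : ZMod d₁) * hz

lemma mem_gen3_iff {d₁ d₂ d₃ b c : ℕ} (h : IsAperyPair d₁ d₂ d₃ b c) {n : ℕ}
    (e : b * d₂ + c * d₃ ≡ n [MOD d₁]) : n ∈ gen3 d₁ d₂ d₃ ↔ b * d₂ + c * d₃ ≤ n := by
  constructor
  · rintro ⟨a, s, t, rfl⟩
    have := h.weight_le (b' := s) (c' := t) (by
      refine Nat.ModEq.trans ?_ e.symm
      rw [add_assoc, add_comm]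
      exact (Nat.modEq_iff_dvd' (by omega)).2 (by simp))
    omega
  · intro hle
    obtain ⟨a, ha⟩ := (Nat.modEq_iff_dvd' hle).1 e
    exact ⟨a, b, c, by rw [mul_comm a]; omega⟩

lemma finite_gaps {d₁ d₂ d₃ : ℕ} (hd₁ : 0 < d₁) (hgcd : Nat.gcd d₁ (Nat.gcd d₂ d₃) = 1)
    {L : Finset (ℕ × ℕ)} (hL : ∀ p : ℕ × ℕ, p ∈ L ↔ IsAperyPair d₁ d₂ d₃ p.1 p.2) :
    (gen3 d₁ d₂ d₃)ᶜ.Finite := by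
  refine (L.finite_toSet.biUnion fun p _ => Set.finite_Iio (p.1 * d₂ + p.2 * d₃)).subset ?_
  intro n hn
  obtain ⟨b, c, e⟩ := exists_modEq_of_gcd_eq_one hd₁ hgcd n
  obtain ⟨b', c', h, e'⟩ := exists_isAperyPair d₁ d₂ d₃ b c
  simp only [Set.mem_iUnion]
  refine ⟨(b', c'), (hL _).2 h, ?_⟩
  by_contra hlt
  exact hn ((mem_gen3_iff h (e'.trans e)).2 (not_lt.1 hlt))

/-- The sum over the gaps of a difference with step `d₁` only depends on the Apéry set. -/
lemma sum_gaps_difference {d₁ d₂ d₃ : ℕ} (hd₁ : 0 < d₁) (hd₂ : 0 < d₂)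
    (hgcd : Nat.gcd d₁ (Nat.gcd d₂ d₃) = 1)
    {L : Finset (ℕ × ℕ)} (hL : ∀ p : ℕ × ℕ, p ∈ L ↔ IsAperyPair d₁ d₂ d₃ p.1 p.2)
    {T : Finset ℕ} (hT : ∀ n, n ∈ T ↔ n ∉ gen3 d₁ d₂ d₃) (f : ℕ → ℝ) :
    ∑ n ∈ T, (f (n + d₁) - f n) =
      ∑ p ∈ L, f (p.1 * d₂ + p.2 * d₃) - ∑ r ∈ Finset.range d₁, f r := by
  have exL : ∀ n, ∃ p ∈ L, p.1 * d₂ + p.2 * d₃ ≡ n [MOD d₁] := fun n => by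
    obtain ⟨b, c, e⟩ := exists_modEq_of_gcd_eq_one hd₁ hgcd n
    obtain ⟨b', c', h, e'⟩ := exists_isAperyPair d₁ d₂ d₃ b c
    exact ⟨(b', c'), (hL _).2 h, e'.trans e⟩
  have uniqL : ∀ p ∈ L, ∀ q ∈ L, p.1 * d₂ + p.2 * d₃ ≡ q.1 * d₂ + q.2 * d₃ [MOD d₁] → p = q :=
    fun p hp q hq e => Prod.ext_iff.2 (((hL p).1 hp).unique hd₂ ((hL q).1 hq) e)
  have hres : ∑ r ∈ Finset.range d₁, f r = ∑ p ∈ L, f ((p.1 * d₂ + p.2 * d₃) % d₁) := by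
    symm
    refine Finset.sum_bij (fun p _ => (p.1 * d₂ + p.2 * d₃) % d₁) ?_ ?_ ?_ ?_
    · exact fun p _ => Finset.mem_range.2 (Nat.mod_lt _ hd₁)
    · exact fun p hp q hq e => uniqL p hp q hq e
    · intro r hr
      obtain ⟨p, hp, e⟩ := exL r
      exact ⟨p, hp, Eq.trans e (Nat.mod_eq_of_lt (Finset.mem_range.1 hr))⟩
    · exact fun _ _ => rfl
  have hmod : ∀ w k, w % d₁ + k * d₁ ≡ w [MOD d₁] := fun w k => by
    simp [Nat.ModEq]
  have hgaps : ∑ n ∈ T, (f (n + d₁) - f n) =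
      ∑ x ∈ L.sigma (fun p => Finset.range ((p.1 * d₂ + p.2 * d₃) / d₁)),
        (f ((x.1.1 * d₂ + x.1.2 * d₃) % d₁ + (x.2 + 1) * d₁) -
          f ((x.1.1 * d₂ + x.1.2 * d₃) % d₁ + x.2 * d₁)) := by
    symm
    refine Finset.sum_bij (fun x _ => (x.1.1 * d₂ + x.1.2 * d₃) % d₁ + x.2 * d₁) ?_ ?_ ?_ ?_
    · rintro ⟨p, k⟩ hx
      obtain ⟨hp, hk⟩ := Finset.mem_sigma.1 hx
      rw [hT, mem_gen3_iff ((hL p).1 hp) (hmod _ _).symm, not_le]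
      have hk' := Finset.mem_range.1 hk
      have h₁ := Nat.mod_add_div (p.1 * d₂ + p.2 * d₃) d₁
      have h₂ := Nat.mul_lt_mul_of_pos_left hk' hd₁
      simp only [mul_comm k] at *
      omega
    · rintro ⟨p, k⟩ hx ⟨q, l⟩ hy e
      obtain ⟨hp, hk⟩ := Finset.mem_sigma.1 hx
      obtain ⟨hq, hl⟩ := Finset.mem_sigma.1 hy
      have hpq : p = q := uniqL p hp q hq
        ((hmod _ k).symm.trans ((show _ = _ from e) ▸ hmod _ l))
      subst hpq
      have : k * d₁ = l * d₁ := Nat.add_left_cancel e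
      rw [Nat.eq_of_mul_eq_mul_right hd₁ this]
    · intro n hn
      obtain ⟨p, hp, e⟩ := exL n
      rw [hT, mem_gen3_iff ((hL p).1 hp) e, not_le] at hn
      refine ⟨⟨p, n / d₁⟩, Finset.mem_sigma.2 ⟨hp, Finset.mem_range.2 ?_⟩, ?_⟩
      · by_contra! hle
        have h₁ := Nat.mod_add_div (p.1 * d₂ + p.2 * d₃) d₁
        have h₂ := Nat.mod_add_div n d₁
        have h₃ := Nat.mul_le_mul_left d₁ hle
        have h₄ : (p.1 * d₂ + p.2 * d₃) % d₁ = n % d₁ := e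
        dsimp only at h₃
        omega
      · have h₄ : (p.1 * d₂ + p.2 * d₃) % d₁ = n % d₁ := e
        dsimp only
        rw [h₄, mul_comm]
        exact Nat.mod_add_div n d₁
    · rintro ⟨p, k⟩ _
      dsimp only
      rw [show (p.1 * d₂ + p.2 * d₃) % d₁ + (k + 1) * d₁ =
        (p.1 * d₂ + p.2 * d₃) % d₁ + k * d₁ + d₁ by ring]
  rw [hgaps, Finset.sum_sigma, hres, ← Finset.sum_sub_distrib]
  refine Finset.sum_congr rfl fun p _ => ?_
  rw [Finset.sum_range_sub (fun k => f ((p.1 * d₂ + p.2 * d₃) % d₁ + k * d₁))]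
  rw [Nat.mod_add_div']
  simp

/-- The Apéry pairs form an L-shaped region. -/
lemma exists_lShape_isAperyPair {d₁ d₂ d₃ : ℕ} (hd₁ : 0 < d₁) (hd₂ : 0 < d₂) :
    ∃ r₂ e₂ r₃ e₃ : ℕ, 0 < r₂ ∧ 0 < r₃ ∧
      (∀ b c, IsAperyPair d₁ d₂ d₃ b c ↔
        (b < r₂ ∧ c < r₃ + e₃) ∨ (r₂ ≤ b ∧ b < r₂ + e₂ ∧ c < r₃)) ∧
      e₃ * d₃ ≤ (r₂ + e₂) * d₂ ∧ e₂ * d₂ ≤ (r₃ + e₃) * d₃ := by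
  have : NeZero d₁ := ⟨hd₁.ne'⟩
  have cast : ∀ b c b' c' : ℕ, b • (d₂ : ZMod d₁) + c • (d₃ : ZMod d₁) =
      b' • (d₂ : ZMod d₁) + c' • (d₃ : ZMod d₁) ↔
      b * d₂ + c * d₃ ≡ b' * d₂ + c' * d₃ [MOD d₁] := fun b c b' c' => by
    rw [← ZMod.natCast_eq_natCast_iff]
    push_cast
    simp only [nsmul_eq_mul]
  obtain ⟨r₂, e₂, r₃, e₃, hr₂, hr₃, hD, hrel⟩ :=
    exists_lShape (u := (d₂ : ZMod d₁)) (v := (d₃ : ZMod d₁)) (D := IsAperyPair d₁ d₂ d₃)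
      (fun b c b' c' h hb hc => h.down hb hc)
      (fun b c b' c' h h' e => h.unique hd₂ h' ((cast _ _ _ _).1 e))
      (fun b c => by
        obtain ⟨b', c', h, e⟩ := exists_isAperyPair d₁ d₂ d₃ b c
        exact ⟨b', c', h, (cast _ _ _ _).2 e⟩)
  refine ⟨r₂, e₂, r₃, e₃, hr₂, hr₃, hD, ?_⟩
  rcases hrel with ⟨rfl, rfl⟩ | ⟨h₂, h₃⟩
  · simp
  · constructor
    · have h := ((hD 0 e₃).2 (Or.inl ⟨hr₂, by omega⟩)).weight_le (b' := r₂ + e₂) (c' := 0)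
        ((cast _ _ _ _).1 (by simpa using h₂))
      simpa using h
    · rcases Nat.eq_zero_or_pos e₂ with rfl | he
      · simp
      have h := ((hD e₂ 0).2 (by omega)).weight_le (b' := 0) (c' := r₃ + e₃)
        ((cast _ _ _ _).1 (by simpa using h₃))
      simpa using h

/-- The Frobenius number in terms of the L-shaped region of Apéry pairs. -/
lemma frobeniusNum_add_eq_max {d₁ d₂ d₃ r₂ e₂ r₃ e₃ : ℕ} (hd₁ : 0 < d₁)
    (hgcd : Nat.gcd d₁ (Nat.gcd d₂ d₃) = 1) (hr₂ : 0 < r₂) (hr₃ : 0 < r₃)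
    (hD : ∀ b c, IsAperyPair d₁ d₂ d₃ b c ↔
        (b < r₂ ∧ c < r₃ + e₃) ∨ (r₂ ≤ b ∧ b < r₂ + e₂ ∧ c < r₃))
    (hfin : (gen3 d₁ d₂ d₃)ᶜ.Finite) (hne : (gen3 d₁ d₂ d₃)ᶜ.Nonempty) :
    frobeniusNum (gen3 d₁ d₂ d₃) + (d₁ + d₂ + d₃) =
      max ((r₂ + e₂) * d₂ + r₃ * d₃) (r₂ * d₂ + (r₃ + e₃) * d₃) := by
  have hmem : frobeniusNum (gen3 d₁ d₂ d₃) ∉ gen3 d₁ d₂ d₃ := Nat.sSup_mem hne hfin.bddAbove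
  have hle : ∀ n, n ∉ gen3 d₁ d₂ d₃ → n ≤ frobeniusNum (gen3 d₁ d₂ d₃) :=
    fun n hn => le_csSup hfin.bddAbove hn
  have lower : ∀ b c, IsAperyPair d₁ d₂ d₃ b c →
      (b + 1) * d₂ + (c + 1) * d₃ ≤ frobeniusNum (gen3 d₁ d₂ d₃) + (d₁ + d₂ + d₃) := by
    intro b c h
    have : b * d₂ + c * d₃ ≤ frobeniusNum (gen3 d₁ d₂ d₃) + d₁ := by
      rcases lt_or_ge (b * d₂ + c * d₃) d₁ with hlt | hge
      · omega
      · obtain ⟨m, hm⟩ := Nat.exists_eq_add_of_le hge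
        have := hle m (by
          rw [mem_gen3_iff h (show _ ≡ m [MOD d₁] by rw [hm]; simp [Nat.ModEq])]
          omega)
        omega
    rw [add_mul, add_mul]
    omega
  apply le_antisymm
  · obtain ⟨b, c, e⟩ := exists_modEq_of_gcd_eq_one hd₁ hgcd (frobeniusNum (gen3 d₁ d₂ d₃))
    obtain ⟨b', c', h, e'⟩ := exists_isAperyPair d₁ d₂ d₃ b c
    have e'' := e'.trans e
    rw [mem_gen3_iff h e'', not_le] at hmem
    have h₁ : frobeniusNum (gen3 d₁ d₂ d₃) + d₁ ≤ b' * d₂ + c' * d₃ := by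
      have := Nat.le_of_dvd (Nat.sub_pos_of_lt hmem) ((Nat.modEq_iff_dvd' hmem.le).1 e''.symm)
      omega
    have h₂ : frobeniusNum (gen3 d₁ d₂ d₃) + (d₁ + d₂ + d₃) ≤ (b' + 1) * d₂ + (c' + 1) * d₃ := by
      rw [add_mul, add_mul]
      omega
    rcases (hD b' c').1 h with h | h
    · refine le_max_of_le_right (h₂.trans ?_)
      exact add_le_add (Nat.mul_le_mul_right _ (by omega)) (Nat.mul_le_mul_right _ (by omega))
    · refine le_max_of_le_left (h₂.trans ?_)
      exact add_le_add (Nat.mul_le_mul_right _ (by omega)) (Nat.mul_le_mul_right _ (by omega))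
  · apply max_le
    · have := lower (r₂ + e₂ - 1) (r₃ - 1) ((hD _ _).2 (by omega))
      rwa [show r₂ + e₂ - 1 + 1 = r₂ + e₂ by omega, show r₃ - 1 + 1 = r₃ by omega] at this
    · have := lower (r₂ - 1) (r₃ + e₃ - 1) ((hD _ _).2 (by omega))
      rwa [show r₃ + e₃ - 1 + 1 = r₃ + e₃ by omega, show r₂ - 1 + 1 = r₂ by omega] at this

/-- The inequality underlying the bounds on `h₂`, in terms of the degrees `x₁, x₂, x₃` of the first
syzygies and `y ≤ g` of the second syzygies. -/
lemma bounds_of_syzygy_power_sums {x₁ x₂ x₃ y g p k K : ℝ} (hp : 0 < p) (hg : 0 < g) (hyg : y ≤ g)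
    (h₁ : x₁ ≤ y) (h₂ : x₂ ≤ y) (h₃ : x₃ ≤ y)
    (e₁ : x₁ + x₂ + x₃ = g + y)
    (e₂ : g ^ 2 + y ^ 2 - x₁ ^ 2 - x₂ ^ 2 - x₃ ^ 2 = 2 * p)
    (e₃ : g ^ 3 + y ^ 3 - x₁ ^ 3 - x₂ ^ 3 - x₃ ^ 3 = 6 * p * k)
    (e₅ : g ^ 5 + y ^ 5 - x₁ ^ 5 - x₂ ^ 5 - x₃ ^ 5 = 60 * p * K) :
    1 / 18 < K / g ^ 3 ∧ K / g ^ 3 < 1 / 9 := by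
  obtain ⟨a, rfl⟩ : ∃ a, x₁ = y - a := ⟨y - x₁, by ring⟩
  obtain ⟨b, rfl⟩ : ∃ b, x₂ = y - b := ⟨y - x₂, by ring⟩
  obtain ⟨c, rfl⟩ : ∃ c, x₃ = y - c := ⟨y - x₃, by ring⟩
  have ha : 0 ≤ a := by linarith
  have hb : 0 ≤ b := by linarith
  have hc : 0 ≤ c := by linarith
  have hgdef : g = 2 * y - (a + b + c) := by linarith
  have hA : a + b + c ≤ g := by linarith
  have hpE : p = y * (g - y) + (a * b + b * c + c * a) := by
    have : 2 * p = 2 * (y * (g - y) + (a * b + b * c + c * a)) := by rw [← e₂, hgdef]; ring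
    linarith
  obtain ⟨w, hw⟩ : ∃ w, 2 * k = g + w := ⟨2 * k - g, by ring⟩
  have hwp : w * p = a * b * c := by
    have hk : 6 * p * k = 3 * p * g + 3 * (w * p) := by linear_combination 3 * p * hw
    have : 3 * p * g + 3 * (w * p) = 3 * p * g + 3 * (a * b * c) := by
      rw [← hk, ← e₃, hpE, hgdef]; ring
    linarith
  have hw0 : 0 ≤ w := nonneg_of_mul_nonneg_left (by rw [hwp]; positivity) hp
  have hK : 12 * K = g ^ 3 - p * g + w * (g ^ 2 + g * y + y ^ 2 - p) := by
    have : 5 * p * (12 * K) = 5 * p * (g ^ 3 - p * g + w * (g ^ 2 + g * y + y ^ 2 - p)) := by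
      have h : 5 * p * (g ^ 3 - p * g + w * (g ^ 2 + g * y + y ^ 2 - p)) =
        5 * p * (g ^ 3 - p * g) + 5 * (w * p) * (g ^ 2 + g * y + y ^ 2 - p) := by ring
      rw [h, hwp, show 5 * p * (12 * K) = 60 * p * K by ring, ← e₅, hpE, hgdef]; ring
    exact mul_left_cancel₀ (by positivity) this
  have hE : 0 ≤ a * b + b * c + c * a := by positivity
  have hy : y = (g + (a + b + c)) / 2 := by rw [hgdef]; ring
  have hp4 : p = (g ^ 2 - (a + b + c) ^ 2) / 4 + (a * b + b * c + c * a) := by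
    rw [hpE, hy]; ring
  have hA2 : (a + b + c) ^ 2 ≤ g ^ 2 := by gcongr
  have hp3 : p ≤ g ^ 2 / 3 := by
    linarith [sq_nonneg (a - b), sq_nonneg (b - c), sq_nonneg (c - a)]
  have hy0 : 0 < y := by linarith
  have hEp : a * b + b * c + c * a ≤ p := by
    linarith [mul_nonneg hy0.le (sub_nonneg.2 hyg)]
  have hP : a * b * c ≤ (a + b + c) * (a * b + b * c + c * a) / 9 := by
    linarith [mul_nonneg ha (sq_nonneg (b - c)), mul_nonneg hb (sq_nonneg (c - a)),
      mul_nonneg hc (sq_nonneg (a - b))]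
  have hw9 : w ≤ g / 9 := by
    have : w * p ≤ g / 9 * p := by
      rw [hwp]
      have := mul_le_mul hA hEp hE hg.le
      linarith
    exact le_of_mul_le_mul_right this hp
  have hgy : g * y ≤ g ^ 2 := by linarith [mul_nonneg hg.le (sub_nonneg.2 hyg)]
  have hyy : y ^ 2 ≤ g ^ 2 := by gcongr
  have hq : 0 < g ^ 2 + g * y + y ^ 2 - p := by
    linarith [mul_pos hg hy0, sq_nonneg y, pow_pos hg 2]
  have hg3 : 0 < g ^ 3 := by positivity
  rw [lt_div_iff₀ hg3, div_lt_iff₀ hg3]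
  constructor
  · rcases hw0.eq_or_lt with h0 | hpos
    · have habc : a * b * c = 0 := by rw [← hwp, ← h0]; ring
      have hp4' : p ≤ g ^ 2 / 4 := by
        rcases mul_eq_zero.1 habc with h | rfl
        · rcases mul_eq_zero.1 h with rfl | rfl
          · linarith [sq_nonneg (b - c)]
          · linarith [sq_nonneg (a - c)]
        · linarith [sq_nonneg (b - a)]
      have : p * g ≤ g ^ 2 / 4 * g := by gcongr
      rw [← h0] at hK
      linarith [show g ^ 2 / 4 * g = g ^ 3 / 4 by ring]
    · have : p * g ≤ g ^ 2 / 3 * g := by gcongr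
      have := mul_pos hpos hq
      linarith [show g ^ 2 / 3 * g = g ^ 3 / 3 by ring]
  · have h : w * (g ^ 2 + g * y + y ^ 2 - p) ≤ g / 9 * (3 * g ^ 2) := by
      apply mul_le_mul hw9 (by linarith) hq.le (by positivity)
    linarith [mul_pos hp hg, show g / 9 * (3 * g ^ 2) = g ^ 3 / 3 by ring]

lemma sum_range_second_difference_pow_five (n : ℕ) (a b : ℝ) :
    ∑ r ∈ Finset.range n, (((r : ℝ) + a + b) ^ 5 - (r + a) ^ 5 - (r + b) ^ 5 + (r : ℝ) ^ 5) =
      20 * n * a * b * ((n + a + b - 1) / 2 *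
        (((n + a + b - 1) / 2) ^ 2 + ((n : ℝ) ^ 2 + a ^ 2 + b ^ 2 - 1) / 4)) := by
  induction n with
  | zero => simp
  | succ n ih => rw [Finset.sum_range_succ, ih]; push_cast; ring

lemma sum_range_second_difference_sq (n : ℕ) (a b : ℝ) :
    ∑ r ∈ Finset.range n, (((r : ℝ) + a + b) ^ 2 - (r + a) ^ 2 - (r + b) ^ 2 + (r : ℝ) ^ 2) =
      2 * n * a * b := by
  induction n with
  | zero => simp
  | succ n ih => rw [Finset.sum_range_succ, ih]; push_cast; ring

lemma sum_range_second_difference_pow_three (n : ℕ) (a b : ℝ) :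
    ∑ r ∈ Finset.range n, (((r : ℝ) + a + b) ^ 3 - (r + a) ^ 3 - (r + b) ^ 3 + (r : ℝ) ^ 3) =
      6 * n * a * b * ((n + a + b - 1) / 2) := by
  induction n with
  | zero => simp
  | succ n ih => rw [Finset.sum_range_succ, ih]; push_cast; ring

/-- Summing a mixed second difference over an L-shaped region of lattice points telescopes. -/
lemma sum_lShape_second_difference (h : ℝ → ℝ) (x y : ℝ) (r₂ e₂ r₃ e₃ : ℕ) :
    (∑ b ∈ Finset.range r₂, ∑ c ∈ Finset.range (r₃ + e₃),
        (h (b * x + c * y + x + y) - h (b * x + c * y + x) - h (b * x + c * y + y)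
          + h (b * x + c * y))) +
      (∑ b ∈ Finset.Ico r₂ (r₂ + e₂), ∑ c ∈ Finset.range r₃,
        (h (b * x + c * y + x + y) - h (b * x + c * y + x) - h (b * x + c * y + y)
          + h (b * x + c * y))) =
      h 0 - h ((r₂ + e₂) * x) - h ((r₃ + e₃) * y) - h (r₂ * x + r₃ * y)
        + h ((r₂ + e₂) * x + r₃ * y) + h (r₂ * x + (r₃ + e₃) * y) := by
  have inner : ∀ b C : ℕ, ∑ c ∈ Finset.range C,
      (h (b * x + c * y + x + y) - h (b * x + c * y + x) - h (b * x + c * y + y)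
          + h (b * x + c * y)) =
      (h ((b + 1 : ℕ) * x + C * y) - h ((b + 1 : ℕ) * x)) - (h (b * x + C * y) - h (b * x)) := by
    intro b C
    induction C with
    | zero => simp
    | succ C ih =>
      rw [Finset.sum_range_succ, ih]
      push_cast
      rw [show (b : ℝ) * x + C * y + x + y = (b + 1) * x + (C + 1) * y by ring,
        show (b : ℝ) * x + C * y + x = (b + 1) * x + C * y by ring,
        show (b : ℝ) * x + C * y + y = b * x + (C + 1) * y by ring]
      ring
  simp only [inner]
  rw [Finset.sum_Ico_eq_sum_range, Finset.sum_range_sub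
    (fun b : ℕ => h ((b : ℝ) * x + (r₃ + e₃ : ℕ) * y) - h (b * x))]
  have := Finset.sum_range_sub
    (fun b : ℕ => h (((r₂ + b : ℕ) : ℝ) * x + (r₃ : ℕ) * y) - h ((r₂ + b : ℕ) * x)) e₂
  simp only [add_tsub_cancel_left, ← add_assoc] at this ⊢
  rw [this]
  push_cast
  simp only [zero_mul, zero_add, add_zero]
  ring

/-- For a non-symmetric `S₃ = ⟨d₁,d₂,d₃⟩` minimally generated by three positive
integers, the rescaled genus `h₂ = K₂/g₃³` satisfies `1/18 < h₂ < 1/9`. -/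
theorem h2_bounds_nonsymmetric (d₁ d₂ d₃ : ℕ) (h : MinGen3 d₁ d₂ d₃)
    (hns : ¬ IsSymmetric (gen3 d₁ d₂ d₃))
    (σ₁ σ₂ δ₁ δ₂ g₃ K₂ h₂ : ℝ)
    (hσ₁ : σ₁ = (d₁ : ℝ) + d₂ + d₃)
    (hσ₂ : σ₂ = (d₁ : ℝ) ^ 2 + (d₂ : ℝ) ^ 2 + (d₃ : ℝ) ^ 2)
    (hδ₁ : δ₁ = (σ₁ - 1) / 2) (hδ₂ : δ₂ = (σ₂ - 1) / 4)
    (hg₃ : g₃ = (frobeniusNum (gen3 d₁ d₂ d₃) : ℝ) + σ₁)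
    (hK₂ : K₂ = (gapPowerSum (gen3 d₁ d₂ d₃) 2 : ℝ) +
        σ₁ * (gapPowerSum (gen3 d₁ d₂ d₃) 1 : ℝ) +
        (3 * σ₁ ^ 2 + σ₂) / 12 * (genus (gen3 d₁ d₂ d₃) : ℝ) +
        δ₁ * (δ₁ ^ 2 + δ₂) / 3)
    (hh₂ : h₂ = K₂ / g₃ ^ 3) :
    1 / 18 < h₂ ∧ h₂ < 1 / 9 := by
  obtain ⟨hd₁, h₁₂, h₂₃, -, hgcd, -⟩ := h
  have hd₁0 : 0 < d₁ := by omega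
  have hd₂0 : 0 < d₂ := by omega
  obtain ⟨r₂, e₂, r₃, e₃, hr₂, hr₃, hD, hx₃, hx₂⟩ :=
    exists_lShape_isAperyPair (d₃ := d₃) hd₁0 hd₂0
  have hdisj : Disjoint (Finset.range r₂ ×ˢ Finset.range (r₃ + e₃))
      (Finset.Ico r₂ (r₂ + e₂) ×ˢ Finset.range r₃) := by
    rw [Finset.disjoint_left]
    intro p hp hq
    simp only [Finset.mem_product, Finset.mem_range, Finset.mem_Ico] at hp hq
    omega
  have hL : ∀ p : ℕ × ℕ, p ∈ (Finset.range r₂ ×ˢ Finset.range (r₃ + e₃)).disjUnion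
      (Finset.Ico r₂ (r₂ + e₂) ×ˢ Finset.range r₃) hdisj ↔ IsAperyPair d₁ d₂ d₃ p.1 p.2 := by
    intro p
    rw [hD]
    simp only [Finset.mem_disjUnion, Finset.mem_product, Finset.mem_range, Finset.mem_Ico,
      and_assoc]
  have hfin := finite_gaps hd₁0 hgcd hL
  have hone : 1 ∉ gen3 d₁ d₂ d₃ := by
    rintro ⟨a, b, c, e⟩
    rcases Nat.eq_zero_or_pos a with rfl | ha
    · rcases Nat.eq_zero_or_pos b with rfl | hb
      · rcases Nat.eq_zero_or_pos c with rfl | hc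
        · omega
        · have := Nat.le_mul_of_pos_left d₃ hc
          omega
      · have := Nat.le_mul_of_pos_left d₂ hb
        omega
    · have := Nat.le_mul_of_pos_left d₁ ha
      omega
  have hfrob := frobeniusNum_add_eq_max hd₁0 hgcd hr₂ hr₃ hD hfin ⟨1, hone⟩
  obtain ⟨T, hTc⟩ := hfin.exists_finset_coe
  have hT : ∀ n, n ∈ T ↔ n ∉ gen3 d₁ d₂ d₃ := fun n => by
    rw [← Finset.mem_coe, hTc, Set.mem_compl_iff]
  have hG : ∀ r, (gapPowerSum (gen3 d₁ d₂ d₃) r : ℝ) = ∑ n ∈ T, (n : ℝ) ^ r := fun r => by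
    rw [gapPowerSum, ← hTc, finsum_mem_coe_finset]
    push_cast
    rfl
  have hG0 : (genus (gen3 d₁ d₂ d₃) : ℝ) = ∑ n ∈ T, (1 : ℝ) := by
    rw [genus, ← hTc, Set.ncard_coe_finset]
    simp
  have key : ∀ φ : ℝ → ℝ,
      ∑ n ∈ T, (((φ ((n : ℝ) + d₁ + d₂ + d₃) - φ ((n : ℝ) + d₁ + d₂) - φ ((n : ℝ) + d₁ + d₃)
          + φ ((n : ℝ) + d₁)) -
        (φ ((n : ℝ) + d₂ + d₃) - φ ((n : ℝ) + d₂) - φ ((n : ℝ) + d₃) + φ n))) +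
        ∑ r ∈ Finset.range d₁,
          (φ ((r : ℝ) + d₂ + d₃) - φ ((r : ℝ) + d₂) - φ ((r : ℝ) + d₃) + φ r) =
      φ 0 - φ ((r₂ + e₂) * d₂) - φ ((r₃ + e₃) * d₃) - φ (r₂ * d₂ + r₃ * d₃)
        + φ ((r₂ + e₂) * d₂ + r₃ * d₃) + φ (r₂ * d₂ + (r₃ + e₃) * d₃) := by
    intro φ
    have h₁ := sum_gaps_difference hd₁0 hd₂0 hgcd hL hT (fun n =>
      φ ((n : ℝ) + d₂ + d₃) - φ ((n : ℝ) + d₂) - φ ((n : ℝ) + d₃) + φ n)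
    have h₂ := sum_lShape_second_difference φ d₂ d₃ r₂ e₂ r₃ e₃
    rw [Finset.sum_disjUnion, Finset.sum_product, Finset.sum_product] at h₁
    push_cast at h₁
    rw [h₂] at h₁
    rw [h₁]
    ring
  have hpow₂ := key (fun t => t ^ 2)
  have hpow₃ := key (fun t => t ^ 3)
  have hpow₅ := key (fun t => t ^ 5)
  simp only [sum_range_second_difference_sq] at hpow₂
  simp only [sum_range_second_difference_pow_three] at hpow₃
  simp only [sum_range_second_difference_pow_five] at hpow₅
  rw [Finset.sum_congr rfl (fun n _ => show _ = (0 : ℝ) by ring), Finset.sum_const_zero] at hpow₂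
  rw [Finset.sum_congr rfl (fun n _ => show _ = 6 * (d₁ : ℝ) * d₂ * d₃ * 1 by ring),
    ← Finset.mul_sum, ← hG0] at hpow₃
  rw [Finset.sum_congr rfl (fun (n : ℕ) _ => show _ = 60 * (d₁ : ℝ) * d₂ * d₃ *
      ((n : ℝ) ^ 2 + σ₁ * (n : ℝ) ^ 1 + (3 * σ₁ ^ 2 + σ₂) / 12 * 1) by rw [hσ₁, hσ₂]; ring),
    ← Finset.mul_sum, Finset.sum_add_distrib, Finset.sum_add_distrib, ← Finset.mul_sum,
    ← Finset.mul_sum, ← hG0, ← hG, ← hG] at hpow₅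
  have hd₁R : (0 : ℝ) < d₁ := by exact_mod_cast hd₁0
  have hd₂R : (0 : ℝ) < d₂ := by exact_mod_cast hd₂0
  have hd₃R : (0 : ℝ) < d₃ := by exact_mod_cast (by omega : 0 < d₃)
  have hg : 0 < g₃ := by
    rw [hg₃, hσ₁]
    positivity
  have hgmax : g₃ = max (((r₂ : ℝ) + e₂) * d₂ + r₃ * d₃) (r₂ * d₂ + ((r₃ : ℝ) + e₃) * d₃) := by
    rw [hg₃, hσ₁]
    exact_mod_cast hfrob
  have hx₃R : (e₃ : ℝ) * d₃ ≤ ((r₂ : ℝ) + e₂) * d₂ := by exact_mod_cast hx₃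
  have hx₂R : (e₂ : ℝ) * d₂ ≤ ((r₃ : ℝ) + e₃) * d₃ := by exact_mod_cast hx₂
  have hnn₂ : 0 ≤ (r₂ : ℝ) * d₂ := by positivity
  have hnn₃ : 0 ≤ (r₃ : ℝ) * d₃ := by positivity
  have hne₂ : 0 ≤ (e₂ : ℝ) * d₂ := by positivity
  have hne₃ : 0 ≤ (e₃ : ℝ) * d₃ := by positivity
  have hp : 0 < (d₁ : ℝ) * d₂ * d₃ := by positivity
  have hK : 60 * ((d₁ : ℝ) * d₂ * d₃) * K₂ = 60 * (d₁ : ℝ) * d₂ * d₃ *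
      ((gapPowerSum (gen3 d₁ d₂ d₃) 2 : ℝ) + σ₁ * (gapPowerSum (gen3 d₁ d₂ d₃) 1 : ℝ) +
        (3 * σ₁ ^ 2 + σ₂) / 12 * (genus (gen3 d₁ d₂ d₃) : ℝ)) +
      20 * d₁ * d₂ * d₃ * ((d₁ + d₂ + d₃ - 1) / 2 * (((d₁ + d₂ + d₃ - 1) / 2) ^ 2 +
        ((d₁ : ℝ) ^ 2 + d₂ ^ 2 + d₃ ^ 2 - 1) / 4)) := by
    rw [hK₂, hδ₁, hδ₂, hσ₁, hσ₂]
    ring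
  rw [hh₂]
  rcases le_total (((r₂ : ℝ) + e₂) * d₂ + r₃ * d₃) (r₂ * d₂ + ((r₃ : ℝ) + e₃) * d₃) with hle | hle
  · rw [max_eq_right hle] at hgmax
    refine bounds_of_syzygy_power_sums (x₁ := (r₂ + e₂) * d₂) (x₂ := (r₃ + e₃) * d₃)
      (x₃ := r₂ * d₂ + r₃ * d₃) (y := (r₂ + e₂) * d₂ + r₃ * d₃) (p := (d₁ : ℝ) * d₂ * d₃)
      (k := genus (gen3 d₁ d₂ d₃) + δ₁) hp hg (hle.trans_eq hgmax.symm)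
      (by linarith) (by linarith) (by linarith) ?_ ?_ ?_ ?_
    · rw [hgmax]; ring
    · rw [hgmax]; linear_combination -hpow₂
    · rw [hgmax, hδ₁, hσ₁]; linear_combination -hpow₃
    · rw [hK, hpow₅, hgmax]; ring
  · rw [max_eq_left hle] at hgmax
    refine bounds_of_syzygy_power_sums (x₁ := (r₂ + e₂) * d₂) (x₂ := (r₃ + e₃) * d₃)
      (x₃ := r₂ * d₂ + r₃ * d₃) (y := r₂ * d₂ + (r₃ + e₃) * d₃) (p := (d₁ : ℝ) * d₂ * d₃)
      (k := genus (gen3 d₁ d₂ d₃) + δ₁) hp hg (hle.trans_eq hgmax.symm)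
      (by linarith) (by linarith) (by linarith) ?_ ?_ ?_ ?_
    · rw [hgmax]; ring
    · rw [hgmax]; linear_combination -hpow₂
    · rw [hgmax, hδ₁, hσ₁]; linear_combination -hpow₃
    · rw [hK, hpow₅, hgmax]; ring
end

section
/- Let S₃ = ⟨d₁,d₂,d₃⟩ be a symmetric numerical semigroup minimally generated by three positive integers. Then h₁ = K₁/g₃² satisfies the identity h₁ = (1/6)·(1 − v/2) with v = π₃/g₃²; equivalently, 12·K₁ = 2·g₃² − π₃. -/
theorem sum_range_cast (n : ℕ) : ∑ i ∈ Finset.range n, (i : ℝ) = n * (n - 1) / 2 := by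
  induction n with
  | zero => simp
  | succ n ih =>
    rw [Finset.sum_range_succ, ih]
    push_cast
    ring

theorem sum_range_cast_sq (n : ℕ) :
    ∑ i ∈ Finset.range n, (i : ℝ) ^ 2 = n * (n - 1) * (2 * n - 1) / 6 := by
  induction n with
  | zero => simp
  | succ n ih =>
    rw [Finset.sum_range_succ, ih]
    push_cast
    ring

/-- A finite family `W` of elements of `S` that is a complete residue system modulo `x` and
consists of the least elements of `S` in their residue classes (an Apéry set of `S`). -/
structure IsAperyFamily {ι : Type*} (S : Set ℕ) (x : ℕ) (T : Finset ι) (W : ι → ℕ) : Prop where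
  injOn : ∀ t ∈ T, ∀ t' ∈ T, W t % x = W t' % x → t = t'
  exists_residue : ∀ n : ℕ, ∃ t ∈ T, W t % x = n % x
  mem_iff : ∀ t ∈ T, ∀ n : ℕ, W t % x = n % x → (n ∈ S ↔ W t ≤ n)

namespace IsAperyFamily

variable {ι : Type*} {S : Set ℕ} {x : ℕ} {T : Finset ι} {W : ι → ℕ}

theorem sum_residue (hW : IsAperyFamily S x T W) (hx : 0 < x) (f : ℕ → ℝ) :
    ∑ t ∈ T, f (W t % x) = ∑ r ∈ Finset.range x, f r := by
  refine Finset.sum_nbij (fun t => W t % x) ?_ ?_ ?_ (fun _ _ => rfl)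
  · intro t _
    exact Finset.mem_range.2 (Nat.mod_lt _ hx)
  · intro t ht t' ht' h
    exact hW.injOn t ht t' ht' h
  · intro r hr
    have hr' : r < x := by simpa using hr
    obtain ⟨t, ht, h⟩ := hW.exists_residue r
    exact ⟨t, ht, by simpa [Nat.mod_eq_of_lt hr'] using h⟩

theorem card_eq (hW : IsAperyFamily S x T W) (hx : 0 < x) : T.card = x := by
  have h := hW.sum_residue hx (fun _ => 1)
  simpa using h

/-- The gaps of `S` are the elements `W t % x + k * x` with `k < W t / x`. -/
theorem compl_eq (hW : IsAperyFamily S x T W) (hx : 0 < x) :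
    (Sᶜ : Set ℕ) = ((T.sigma fun t => Finset.range (W t / x)).image
      fun u => W u.1 % x + u.2 * x : Finset ℕ) := by
  ext n
  simp only [Set.mem_compl_iff, Finset.coe_image, Set.mem_image, Finset.mem_coe,
    Finset.mem_sigma, Finset.mem_range]
  constructor
  · intro hn
    obtain ⟨t, ht, h⟩ := hW.exists_residue n
    rw [hW.mem_iff t ht n h, not_le] at hn
    refine ⟨⟨t, n / x⟩, ⟨ht, ?_⟩, ?_⟩
    · by_contra hc
      have h1 := Nat.mul_le_mul_left x (not_lt.1 hc)
      have h2 := Nat.mod_add_div n x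
      have h3 := Nat.mod_add_div (W t) x
      simp only at h1
      omega
    · simp only [h]
      rw [mul_comm]
      exact Nat.mod_add_div n x
  · rintro ⟨⟨t, k⟩, ⟨ht, hk⟩, rfl⟩
    simp only at ht hk ⊢
    rw [hW.mem_iff t ht _ (by simp), not_le]
    have h1 := Nat.mul_lt_mul_of_pos_right hk hx
    have h3 := Nat.mod_add_div' (W t) x
    omega

theorem injOn_gaps (hW : IsAperyFamily S x T W) (hx : 0 < x) :
    Set.InjOn (fun u : (_ : ι) × ℕ => W u.1 % x + u.2 * x)
      (T.sigma fun t => Finset.range (W t / x)) := by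
  rintro ⟨t, k⟩ hu ⟨t', k'⟩ hu' h
  simp only [Finset.coe_sigma, Set.mem_sigma_iff, Finset.mem_coe] at hu hu'
  simp only at h
  have hr : W t % x = W t' % x := by
    have := congrArg (· % x) h
    simpa using this
  obtain rfl := hW.injOn t hu.1 t' hu'.1 hr
  have : k = k' := Nat.eq_of_mul_eq_mul_right hx (by omega)
  rw [this]

theorem genus_eq (hW : IsAperyFamily S x T W) (hx : 0 < x) :
    (x : ℝ) * genus S = ∑ t ∈ T, (W t : ℝ) - x * (x - 1) / 2 := by
  have hr := hW.sum_residue hx (fun r => (r : ℝ))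
  have hg : genus S = ∑ t ∈ T, W t / x := by
    rw [genus, hW.compl_eq hx, Set.ncard_coe_finset, Finset.card_image_of_injOn (hW.injOn_gaps hx),
      Finset.card_sigma]
    simp
  have hw : ∀ t, (x : ℝ) * ((W t / x : ℕ) : ℝ) = W t - ((W t % x : ℕ) : ℝ) := by
    intro t
    have h : (((W t % x + x * (W t / x) : ℕ)) : ℝ) = W t := by rw [Nat.mod_add_div]
    push_cast at h
    linarith
  rw [sum_range_cast] at hr
  rw [hg, Nat.cast_sum, Finset.mul_sum, Finset.sum_congr rfl (fun t _ => hw t),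
    Finset.sum_sub_distrib, hr]

theorem gapPowerSum_one_eq (hW : IsAperyFamily S x T W) (hx : 0 < x) :
    2 * (x : ℝ) * gapPowerSum S 1 = ∑ t ∈ T, (W t : ℝ) ^ 2 - x * ∑ t ∈ T, (W t : ℝ)
      - x * (x - 1) * (2 * x - 1) / 6 + x * (x * (x - 1) / 2) := by
  have hr := hW.sum_residue hx (fun r => (r : ℝ))
  have hr2 := hW.sum_residue hx (fun r => (r : ℝ) ^ 2)
  have hg : gapPowerSum S 1 = ∑ t ∈ T, ∑ k ∈ Finset.range (W t / x), (W t % x + k * x) := by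
    rw [gapPowerSum, hW.compl_eq hx, finsum_mem_coe_finset, Finset.sum_image (hW.injOn_gaps hx),
      Finset.sum_sigma]
    simp
  have hw : ∀ t, 2 * (x : ℝ) * ∑ k ∈ Finset.range (W t / x), (((W t % x : ℕ) : ℝ) + k * x)
      = (W t : ℝ) ^ 2 - x * W t - ((W t % x : ℕ) : ℝ) ^ 2 + x * ((W t % x : ℕ) : ℝ) := by
    intro t
    have h : (((W t % x + x * (W t / x) : ℕ)) : ℝ) = W t := by rw [Nat.mod_add_div]
    push_cast at h
    rw [Finset.sum_add_distrib, ← Finset.sum_mul, sum_range_cast, Finset.sum_const,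
      Finset.card_range, nsmul_eq_mul, ← h]
    ring
  rw [sum_range_cast] at hr
  rw [sum_range_cast_sq] at hr2
  rw [hg]
  push_cast
  rw [Finset.mul_sum, Finset.sum_congr rfl (fun t _ => hw t), Finset.sum_add_distrib,
    Finset.sum_sub_distrib, Finset.sum_sub_distrib, ← Finset.mul_sum, ← Finset.mul_sum, hr, hr2]

end IsAperyFamily

/-- If `F + x` has a unique representation by `y` and `z`, the Apéry set of a symmetric
`⟨x, y, z⟩` with respect to `x` is a rectangle. -/
theorem isAperyFamily_rectangle {x y z F A B : ℕ} (hx : 0 < x) (hF : F ∉ gen3 x y z)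
    (hlarge : ∀ n, F < n → n ∈ gen3 x y z)
    (hsym : ∀ n ≤ F, n ∉ gen3 x y z → F - n ∈ gen3 x y z)
    (hAB : A * y + B * z = F + x)
    (huniq : ∀ a b, a * y + b * z = F + x → a = A ∧ b = B) :
    IsAperyFamily (gen3 x y z) x (Finset.range (A + 1) ×ˢ Finset.range (B + 1))
      (fun t => t.1 * y + t.2 * z) := by
  have hadd : ∀ m ∈ gen3 x y z, ∀ k, m + k * x ∈ gen3 x y z := by
    rintro m ⟨a, b, c, rfl⟩ k
    exact ⟨a + k, b, c, by ring⟩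
  have hmem : ∀ t ∈ Finset.range (A + 1) ×ˢ Finset.range (B + 1), ∀ n : ℕ,
      (t.1 * y + t.2 * z) % x = n % x → (n ∈ gen3 x y z ↔ t.1 * y + t.2 * z ≤ n) := by
    rintro ⟨i, j⟩ ht n hn
    simp only [Finset.mem_product, Finset.mem_range, Nat.lt_succ_iff] at ht hn ⊢
    obtain ⟨⟨i', rfl⟩, ⟨j', rfl⟩⟩ :=
      And.intro (Nat.exists_eq_add_of_le ht.1) (Nat.exists_eq_add_of_le ht.2)
    constructor
    · rintro ⟨a, b, c, rfl⟩
      by_contra hlt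
      rw [not_le] at hlt
      obtain ⟨k, hk⟩ := (Nat.modEq_iff_dvd' hlt.le).1 hn.symm
      have hk' : i * y + j * z = a * x + b * y + c * z + x * k := by omega
      obtain _ | k := k
      · omega
      · refine hF ⟨a + k, b + i', c + j', ?_⟩
        have h1 : (i + i') * y + (j + j') * z = F + x := hAB
        nlinarith
    · intro hle
      obtain ⟨k, hk⟩ := (Nat.modEq_iff_dvd' hle).1 hn
      exact ⟨k, i, j, by rw [mul_comm k x]; omega⟩
  refine ⟨?_, ?_, hmem⟩
  · rintro ⟨i, j⟩ ht ⟨i', j'⟩ ht' h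
    have hS : ∀ u v : ℕ, u * y + v * z ∈ gen3 x y z := fun u v => ⟨0, u, v, by ring⟩
    have h1 := (hmem _ ht _ h).1 (hS i' j')
    have h2 := (hmem _ ht' _ h.symm).1 (hS i j)
    simp only [Finset.mem_product, Finset.mem_range, Nat.lt_succ_iff] at ht ht' h1 h2
    have heq : i * y + j * z = i' * y + j' * z := le_antisymm h1 h2
    obtain ⟨⟨u, hu⟩, ⟨v, hv⟩⟩ :=
      And.intro (Nat.exists_eq_add_of_le ht.1) (Nat.exists_eq_add_of_le ht.2)
    obtain ⟨h3, h4⟩ := huniq (i' + u) (j' + v) (by rw [← hAB, hu, hv]; linarith)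
    ext <;> simp only <;> omega
  · intro n
    classical
    have hex : ∃ m, m ∈ gen3 x y z ∧ m % x = n % x := by
      refine ⟨n + (F + 1) * x, hlarge _ ?_, by simp⟩
      nlinarith
    obtain ⟨⟨a, b, c, hw⟩, hwn⟩ := Nat.find_spec hex
    have hmin := fun m => Nat.find_min hex (m := m)
    set w := Nat.find hex
    obtain _ | a := a
    swap
    · exfalso
      refine hmin (a * x + b * y + c * z) (by rw [hw]; nlinarith) ⟨⟨a, b, c, rfl⟩, ?_⟩
      rw [← hwn, hw, show (a + 1) * x + b * y + c * z = a * x + b * y + c * z + x by ring,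
        Nat.add_mod_right]
    have hcompl : ∃ w' ∈ gen3 x y z, w + w' = F + x := by
      rcases lt_or_ge w x with hlt | hge
      · exact ⟨F + x - w, hlarge _ (by omega), by omega⟩
      · have hgap : w - x ∉ gen3 x y z := fun hc => hmin (w - x) (by omega)
          ⟨hc, by rw [← hwn, Nat.mod_eq_sub_mod hge]⟩
        have hle : w - x ≤ F := by
          by_contra hc
          exact hgap (hlarge _ (by omega))
        exact ⟨F - (w - x), hsym _ hle hgap, by omega⟩
    obtain ⟨w', ⟨a', b', c', rfl⟩, hsum⟩ := hcompl
    obtain _ | a' := a'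
    swap
    · exfalso
      exact hF ⟨a', b + b', c + c', by nlinarith⟩
    obtain ⟨h1, h2⟩ := huniq (b + b') (c + c') (by rw [← hsum, hw]; ring)
    refine ⟨(b, c), ?_, ?_⟩
    · simp only [Finset.mem_product, Finset.mem_range]
      omega
    · rw [← hwn, hw]
      simp

theorem sum_rectangle (p q : ℕ) (y z : ℝ) :
    ∑ t ∈ Finset.range p ×ˢ Finset.range q, ((t.1 : ℝ) * y + t.2 * z) =
      q * y * (p * (p - 1) / 2) + p * z * (q * (q - 1) / 2) := by
  simp only [Finset.sum_product, Finset.sum_add_distrib, Finset.sum_const, Finset.card_range,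
    nsmul_eq_mul, ← Finset.sum_mul, ← Finset.mul_sum, sum_range_cast]
  ring

theorem sum_sq_rectangle (p q : ℕ) (y z : ℝ) :
    ∑ t ∈ Finset.range p ×ˢ Finset.range q, ((t.1 : ℝ) * y + t.2 * z) ^ 2 =
      q * y ^ 2 * (p * (p - 1) * (2 * p - 1) / 6) + p * z ^ 2 * (q * (q - 1) * (2 * q - 1) / 6)
        + 2 * y * z * (p * (p - 1) / 2) * (q * (q - 1) / 2) := by
  have h : ∀ t : ℕ × ℕ, ((t.1 : ℝ) * y + t.2 * z) ^ 2 =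
      (t.1 : ℝ) ^ 2 * y ^ 2 + (t.2 : ℝ) ^ 2 * z ^ 2 + (t.1 : ℝ) * (t.2 * (2 * y * z)) := by
    intro t
    ring
  simp only [h, Finset.sum_product, Finset.sum_add_distrib, Finset.sum_const, Finset.card_range,
    nsmul_eq_mul, ← Finset.sum_mul, ← Finset.mul_sum, sum_range_cast, sum_range_cast_sq]
  ring

/-- The identity `12 K₁ = 2 g₃² - π₃` when `F + x` has a unique representation by `y`, `z`. -/
theorem gap_identity_of_unique {x y z F A B : ℕ} (hx : 0 < x) (hF : F ∉ gen3 x y z)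
    (hlarge : ∀ n, F < n → n ∈ gen3 x y z)
    (hsym : ∀ n ≤ F, n ∉ gen3 x y z → F - n ∈ gen3 x y z)
    (hAB : A * y + B * z = F + x)
    (huniq : ∀ a b, a * y + b * z = F + x → a = A ∧ b = B) :
    12 * ((gapPowerSum (gen3 x y z) 1 : ℝ) + ((x : ℝ) + y + z) / 2 * genus (gen3 x y z)
      + (3 * (((x : ℝ) + y + z - 1) / 2) ^ 2 + ((x : ℝ) ^ 2 + y ^ 2 + z ^ 2 - 1) / 4) / 6)
      = 2 * ((F : ℝ) + (x + y + z)) ^ 2 - x * y * z := by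
  have hW := isAperyFamily_rectangle hx hF hlarge hsym hAB huniq
  have hcard := hW.card_eq hx
  have h0 := hW.genus_eq hx
  have h1 := hW.gapPowerSum_one_eq hx
  rw [Finset.card_product, Finset.card_range, Finset.card_range] at hcard
  push_cast at h0 h1
  rw [sum_rectangle] at h0 h1
  rw [sum_sq_rectangle] at h1
  have hFR : (F : ℝ) = A * y + B * z - x := by
    have : ((A * y + B * z : ℕ) : ℝ) = ((F + x : ℕ) : ℝ) := by rw [hAB]
    push_cast at this
    linarith
  have hxR : (x : ℝ) = (A + 1) * (B + 1) := by
    rw [← hcard]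
    push_cast
    ring
  have hx0 : (x : ℝ) ≠ 0 := by positivity
  apply mul_left_cancel₀ hx0
  have hexp : (x : ℝ) * (12 * ((gapPowerSum (gen3 x y z) 1 : ℝ)
      + ((x : ℝ) + y + z) / 2 * genus (gen3 x y z)
      + (3 * (((x : ℝ) + y + z - 1) / 2) ^ 2 + ((x : ℝ) ^ 2 + y ^ 2 + z ^ 2 - 1) / 4) / 6))
      = 6 * (2 * x * gapPowerSum (gen3 x y z) 1)
        + 6 * ((x : ℝ) + y + z) * (x * genus (gen3 x y z))
        + x * (2 * (3 * (((x : ℝ) + y + z - 1) / 2) ^ 2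
          + ((x : ℝ) ^ 2 + y ^ 2 + z ^ 2 - 1) / 4)) := by
    ring
  rw [hexp, h0, h1, hFR]
  push_cast
  rw [hxR]
  ring

theorem gen3_swap (x y z : ℕ) : gen3 x y z = gen3 z y x := by
  ext n
  constructor <;> rintro ⟨a, b, c, rfl⟩ <;> exact ⟨c, b, a, by ring⟩

/-- A nonunique representation of `n` by `y` and `z` allows one to trade a multiple of `y`
for an equal positive multiple of `z`. -/
theorem exists_trade_of_not_unique {y z n A B : ℕ} (hy : 0 < y) (hz : 0 < z)
    (hAB : A * y + B * z = n) (h : ¬ ∀ a b, a * y + b * z = n → a = A ∧ b = B) :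
    ∃ p q u v, 0 < q ∧ p * y = q * z ∧ n = p * y + u * y + v * z := by
  push Not at h
  obtain ⟨a, b, hab, hne⟩ := h
  rcases lt_trichotomy a A with hlt | rfl | hgt
  · obtain ⟨p, rfl⟩ := Nat.exists_eq_add_of_lt hlt
    have hBb : B < b := by
      by_contra hc
      have := Nat.mul_le_mul_right z (not_lt.1 hc)
      nlinarith
    obtain ⟨q, rfl⟩ := Nat.exists_eq_add_of_lt hBb
    exact ⟨p + 1, q + 1, a, B, by omega, by linarith, by linarith⟩
  · exact absurd (Nat.eq_of_mul_eq_mul_right hz (by omega)) (hne rfl)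
  · obtain ⟨p, rfl⟩ := Nat.exists_eq_add_of_lt hgt
    have hbB : b < B := by
      by_contra hc
      have := Nat.mul_le_mul_right z (not_lt.1 hc)
      nlinarith
    obtain ⟨q, rfl⟩ := Nat.exists_eq_add_of_lt hbB
    exact ⟨p + 1, q + 1, A, b, by omega, by linarith, by linarith⟩

/-- If `F` is a gap of `⟨x, y, z⟩`, the representations of `F + x` by `y, z` and of `F + z` by
`y, x` cannot both be nonunique. -/
theorem mem_gen3_of_trades {x y z F p q u v p' q' u' v' : ℕ} (hq : 0 < q) (hq' : 0 < q')
    (h : p * y = q * z) (hF : F + x = p * y + u * y + v * z)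
    (h' : p' * y = q' * x) (hF' : F + z = p' * y + u' * y + v' * x) : F ∈ gen3 x y z := by
  obtain ⟨q, rfl⟩ := Nat.exists_eq_succ_of_ne_zero hq.ne'
  obtain ⟨q', rfl⟩ := Nat.exists_eq_succ_of_ne_zero hq'.ne'
  rw [Nat.succ_eq_add_one] at h h'
  rcases le_total p p' with hle | hle
  · obtain ⟨k, rfl⟩ := Nat.exists_eq_add_of_le hle
    exact ⟨v', k + u', q, by linarith⟩
  · obtain ⟨k, rfl⟩ := Nat.exists_eq_add_of_le hle
    exact ⟨q', k + u, v, by linarith⟩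

theorem exists_rep_of_gap {x y z F : ℕ} (hx : 0 < x) (hF : F ∉ gen3 x y z)
    (hlarge : ∀ n, F < n → n ∈ gen3 x y z) : ∃ A B, A * y + B * z = F + x := by
  obtain ⟨a, b, c, h⟩ := hlarge (F + x) (by omega)
  obtain _ | a := a
  · exact ⟨b, c, by rw [h]; ring⟩
  · exact absurd ⟨a, b, c, by linarith⟩ hF

theorem gap_identity {x y z F : ℕ} (hx : 0 < x) (hy : 0 < y) (hz : 0 < z)
    (hF : F ∉ gen3 x y z) (hlarge : ∀ n, F < n → n ∈ gen3 x y z)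
    (hsym : ∀ n ≤ F, n ∉ gen3 x y z → F - n ∈ gen3 x y z) :
    12 * ((gapPowerSum (gen3 x y z) 1 : ℝ) + ((x : ℝ) + y + z) / 2 * genus (gen3 x y z)
      + (3 * (((x : ℝ) + y + z - 1) / 2) ^ 2 + ((x : ℝ) ^ 2 + y ^ 2 + z ^ 2 - 1) / 4) / 6)
      = 2 * ((F : ℝ) + (x + y + z)) ^ 2 - x * y * z := by
  obtain ⟨A, B, hAB⟩ := exists_rep_of_gap hx hF hlarge
  by_cases huniq : ∀ a b, a * y + b * z = F + x → a = A ∧ b = B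
  · exact gap_identity_of_unique hx hF hlarge hsym hAB huniq
  obtain ⟨p, q, u, v, hq, hpq, hrep⟩ := exists_trade_of_not_unique hy hz hAB huniq
  have hF' := hF
  have hlarge' := hlarge
  rw [gen3_swap] at hF' hsym hlarge'
  obtain ⟨A', B', hAB'⟩ := exists_rep_of_gap hz hF' hlarge'
  by_cases huniq' : ∀ a b, a * y + b * x = F + z → a = A' ∧ b = B'
  · have key := gap_identity_of_unique hz hF' hlarge' hsym hAB' huniq'
    rw [gen3_swap x y z]
    linear_combination key
  obtain ⟨p', q', u', v', hq', hpq', hrep'⟩ := exists_trade_of_not_unique hy hx hAB' huniq'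
  exact absurd (mem_gen3_of_trades hq hq' hpq hrep hpq' hrep') hF

/-- A semigroup generated by three integers with greatest common divisor `1` contains all large
integers. -/
theorem exists_forall_ge_mem_gen3 {x y z : ℕ} (hgcd : Nat.gcd x (Nat.gcd y z) = 1) :
    ∃ c, ∀ n ≥ c, n ∈ gen3 x y z := by
  obtain ⟨c, hc⟩ := Nat.exists_mem_closure_of_ge {x, y, z}
  have hset : Nat.setGcd {x, y, z} = 1 := by
    refine Nat.dvd_one.1 (hgcd ▸ Nat.dvd_gcd ?_ (Nat.dvd_gcd ?_ ?_)) <;>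
      exact Nat.setGcd_dvd_of_mem (by simp)
  refine ⟨c, fun n hn => ?_⟩
  refine AddSubmonoid.closure_induction (motive := fun n _ => n ∈ gen3 x y z) ?_ ?_ ?_
    (hc n hn (by simp [hset]))
  · rintro m (rfl | rfl | rfl)
    · exact ⟨1, 0, 0, by ring⟩
    · exact ⟨0, 1, 0, by ring⟩
    · exact ⟨0, 0, 1, by ring⟩
  · exact ⟨0, 0, 0, by ring⟩
  · rintro _ _ - - ⟨a, b, c, rfl⟩ ⟨a', b', c', rfl⟩
    exact ⟨a + a', b + b', c + c', by ring⟩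

theorem isGreatest_frobeniusNum {S : Set ℕ} {c m : ℕ} (hc : ∀ n ≥ c, n ∈ S) (hm : m ∉ S) :
    IsGreatest (Sᶜ : Set ℕ) (frobeniusNum S) := by
  have hbdd : BddAbove (Sᶜ : Set ℕ) := by
    refine ⟨c, fun n hn => ?_⟩
    by_contra hlt
    exact hn (hc n (by omega))
  exact ⟨Nat.sSup_mem ⟨m, hm⟩ hbdd, fun n hn => le_csSup hbdd hn⟩

theorem conductorNum_eq {S : Set ℕ} {F : ℕ} (hF : IsGreatest (Sᶜ : Set ℕ) F) :
    conductorNum S = F + 1 := by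
  refine IsLeast.csInf_eq ⟨fun n hn => ?_, fun c hc => ?_⟩
  · by_contra hnS
    have := hF.2 hnS
    omega
  · by_contra hlt
    exact hF.1 (hc F (by omega))

/-- For a symmetric `S₃ = ⟨d₁,d₂,d₃⟩` minimally generated by three positive integers,
`h₁ = K₁/g₃²` satisfies `h₁ = (1/6)·(1 − v/2)` with `v = π₃/g₃²`;
equivalently `12·K₁ = 2·g₃² − π₃`. -/
theorem h1_identity_symmetric (d₁ d₂ d₃ : ℕ) (h : MinGen3 d₁ d₂ d₃)
    (hsym : IsSymmetric (gen3 d₁ d₂ d₃))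
    (σ₁ σ₂ δ₁ δ₂ π₃ g₃ v K₁ h₁ : ℝ)
    (hσ₁ : σ₁ = (d₁ : ℝ) + d₂ + d₃)
    (hσ₂ : σ₂ = (d₁ : ℝ) ^ 2 + (d₂ : ℝ) ^ 2 + (d₃ : ℝ) ^ 2)
    (hδ₁ : δ₁ = (σ₁ - 1) / 2) (hδ₂ : δ₂ = (σ₂ - 1) / 4)
    (hπ₃ : π₃ = (d₁ : ℝ) * d₂ * d₃)
    (hg₃ : g₃ = (frobeniusNum (gen3 d₁ d₂ d₃) : ℝ) + σ₁)
    (hv : v = π₃ / g₃ ^ 2)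
    (hK₁ : K₁ = (gapPowerSum (gen3 d₁ d₂ d₃) 1 : ℝ) +
        σ₁ / 2 * (genus (gen3 d₁ d₂ d₃) : ℝ) + (3 * δ₁ ^ 2 + δ₂) / 6)
    (hh₁ : h₁ = K₁ / g₃ ^ 2) :
    h₁ = 1 / 6 * (1 - v / 2) ∧ 12 * K₁ = 2 * g₃ ^ 2 - π₃ := by
  obtain ⟨h3, h12, h23, -, hgcd, -⟩ := h
  obtain ⟨c, hc⟩ := exists_forall_ge_mem_gen3 hgcd
  have hone : 1 ∉ gen3 d₁ d₂ d₃ := by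
    rintro ⟨a, b, e, habe⟩
    rcases Nat.eq_zero_or_pos a with rfl | ha
    · rcases Nat.eq_zero_or_pos b with rfl | hb
      · rcases Nat.eq_zero_or_pos e with rfl | he
        · omega
        · nlinarith
      · nlinarith
    · nlinarith
  have hgr := isGreatest_frobeniusNum hc hone
  have hcond := conductorNum_eq hgr
  have key := gap_identity (by omega) (by omega) (by omega) hgr.1
    (fun n hn => by
      by_contra hnS
      exact absurd (hgr.2 hnS) (not_le.2 hn))
    (fun n hn hnS => by
      have hs := (hsym n (by omega)).1 hnS
      rwa [hcond, Nat.add_sub_cancel] at hs)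
  have hK : 12 * K₁ = 2 * g₃ ^ 2 - π₃ := by
    rw [hK₁, hg₃, hπ₃, hδ₁, hδ₂, hσ₁, hσ₂]
    exact key
  refine ⟨?_, hK⟩
  have hg0 : g₃ ≠ 0 := by
    have : (0 : ℝ) < d₁ := by exact_mod_cast (by omega : 0 < d₁)
    rw [hg₃, hσ₁]
    positivity
  rw [hh₁, hv]
  field_simp
  linarith
end
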